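/- arXiv:2210.17210 — 8 statements merged into one kernel-verified Lean document; each statement's English description precedes it below -/
import Mathlib

section
/- Let λ be a cardinal with λ^ℵ₀ = λ > 2^ℵ₀, and let K be a reduced torsion abelian group with #K < λ such that either Γ_p(K) is infinite for some prime p, or Γ_p(K) ≠ 0 for infinitely many primes p. Then there exists an abelian group G such that: the torsion subgroup of G is isomorphic to K; #G = λ; G is boundedly endo-rigid; and moreover the quotient ring End(G)/BEnd(G) is isomorphic to ℤ (equivalently, the sequence 0 → ℤ → End(G) → End(G)/BEnd(G) → 0 is exact). -/
open Cardinal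

/-- The `n`-power torsion subgroup `Γ_n(G) = {g : ∃ k, n ^ k • g = 0}`. -/
def Gamma (G : Type*) [AddCommGroup G] (n : ℕ) : AddSubgroup G where
  carrier := {g | ∃ k : ℕ, n ^ k • g = 0}
  zero_mem' := ⟨0, smul_zero _⟩
  add_mem' := by
    intro a b ha hb
    obtain ⟨k, hk⟩ := ha
    obtain ⟨l, hl⟩ := hb
    refine ⟨k + l, ?_⟩
    have ha' : n ^ (k + l) • a = 0 := by rw [pow_add, mul_comm, mul_smul, hk, smul_zero]
    have hb' : n ^ (k + l) • b = 0 := by rw [pow_add, mul_smul, hl, smul_zero]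
    rw [smul_add, ha', hb', add_zero]
  neg_mem' := by
    intro a ha
    obtain ⟨k, hk⟩ := ha
    exact ⟨k, by rw [smul_neg, hk, neg_zero]⟩

/-- The torsion subgroup `tor(G)` of `G`. -/
def torsionSub (G : Type*) [AddCommGroup G] : AddSubgroup G where
  carrier := {g | ∃ k : ℕ, 0 < k ∧ k • g = 0}
  zero_mem' := ⟨1, one_pos, smul_zero _⟩
  add_mem' := by
    intro a b ha hb
    obtain ⟨k, hk, hka⟩ := ha
    obtain ⟨l, hl, hlb⟩ := hb
    refine ⟨k * l, Nat.mul_pos hk hl, ?_⟩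
    have ha' : (k * l) • a = 0 := by rw [mul_comm, mul_smul, hka, smul_zero]
    have hb' : (k * l) • b = 0 := by rw [mul_smul, hlb, smul_zero]
    rw [smul_add, ha', hb', add_zero]
  neg_mem' := by
    intro a ha
    obtain ⟨k, hk, hka⟩ := ha
    exact ⟨k, hk, by rw [smul_neg, hka, neg_zero]⟩

/-- A homomorphism of abelian groups is bounded when its range is a bounded group. -/
def HasBoundedRange {G H : Type*} [AddCommGroup G] [AddCommGroup H] (f : G →+ H) : Prop :=
  ∃ n : ℕ, 1 ≤ n ∧ ∀ x, n • f x = 0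

/-- `G` is boundedly endo-rigid: every endomorphism is `m • id` plus a bounded map. -/
def BoundedlyEndoRigid (G : Type*) [AddCommGroup G] : Prop :=
  ∀ f : G →+ G, ∃ m : ℤ, ∃ n : ℕ, 1 ≤ n ∧ ∀ x : G, n • (f x - m • x) = 0

/-- `G` is co-Hopfian: every injective endomorphism is surjective. -/
def CoHopfian (G : Type*) [AddCommGroup G] : Prop :=
  ∀ f : G →+ G, Function.Injective f → Function.Surjective f

/-- A subgroup is bounded if some `n ≥ 1` kills all its elements. -/
def IsBoundedSubgroup {G : Type*} [AddCommGroup G] (A : AddSubgroup G) : Prop :=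
  ∃ n : ℕ, 1 ≤ n ∧ ∀ x ∈ A, n • x = 0

/-- A subgroup is divisible if each of its elements is divisible, within the
subgroup, by every `n ≥ 1`. -/
def DivisibleSubgroup {G : Type*} [AddCommGroup G] (A : AddSubgroup G) : Prop :=
  ∀ n : ℕ, 0 < n → ∀ a ∈ A, ∃ b ∈ A, n • b = a

/-- A group is reduced if its only divisible subgroup is `0`. -/
def Reduced (G : Type*) [AddCommGroup G] : Prop :=
  ∀ A : AddSubgroup G, DivisibleSubgroup A → A = ⊥

/-- A subgroup `A ≤ G` is pure if `nG ∩ A = nA` for all integers `n`. -/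
def IsPureSubgroup {G : Type*} [AddCommGroup G] (A : AddSubgroup G) : Prop :=
  ∀ n : ℤ, ∀ a ∈ A, (∃ g : G, n • g = a) → ∃ b ∈ A, n • b = a

/-- The restriction of an endomorphism of `G` mapping `Γ_n(G)` into itself. -/
def restrictGamma {G : Type*} [AddCommGroup G] (n : ℕ) (h : G →+ G)
    (hmem : ∀ x ∈ Gamma G n, h x ∈ Gamma G n) : Gamma G n →+ Gamma G n where
  toFun x := ⟨h x.1, hmem x.1 x.2⟩
  map_zero' := Subtype.ext (by simp)
  map_add' x y := Subtype.ext (by simp)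

/-- An `(m, n)`-anti-witness for `G` (for `m ∣ n`): a bounded endomorphism `h` of
`Γ_n(G)` such that `h' = m • id + h` is injective, and either `h'` is not surjective, or
`m > 1` and `G/Γ_n(G)` is not `m`-divisible. -/
def IsAntiWitness (G : Type*) [AddCommGroup G] (m n : ℕ) (h : Gamma G n →+ Gamma G n) : Prop :=
  (∃ k : ℕ, 1 ≤ k ∧ ∀ x, k • h x = 0) ∧
  Function.Injective (fun x : Gamma G n => m • x + h x) ∧
  (¬ Function.Surjective (fun x : Gamma G n => m • x + h x) ∨
    (1 < m ∧ ¬ (∀ y : G ⧸ Gamma G n, ∃ z, m • z = y)))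

/-- `NQr_{(m,n)}(G)`: there exists an `(m,n)`-anti-witness. -/
def NQrAt (G : Type*) [AddCommGroup G] (m n : ℕ) : Prop :=
  ∃ h : Gamma G n →+ Gamma G n, IsAntiWitness G m n h

/-- `NQr(G)`: `NQr_{(m,n)}(G)` for some `m, n ≥ 1` with `m ∣ n`. -/
def NQr (G : Type*) [AddCommGroup G] : Prop :=
  ∃ m n : ℕ, 1 ≤ m ∧ 1 ≤ n ∧ m ∣ n ∧ NQrAt G m n

/-- `Qr(G)`: the negation of `NQr(G)`. -/
def Qr (G : Type*) [AddCommGroup G] : Prop := ¬ NQr G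

/-- `Qr_*(G)`: `Qr(G)` holds and `Γ_p(G)` is unbounded for at least one prime `p`. -/
def QrStar (G : Type*) [AddCommGroup G] : Prop :=
  Qr G ∧ ∃ p : ℕ, p.Prime ∧ ¬ IsBoundedSubgroup (Gamma G p)

/-- `S_G`: the set of primes `p` such that `G/Γ_p(G)` is not `p`-divisible. -/
def SGset (G : Type*) [AddCommGroup G] : Set ℕ :=
  {p | p.Prime ∧ ¬ (∀ y : G ⧸ Gamma G p, ∃ z : G ⧸ Gamma G p, p • z = y)}

universe u

/-- The points reachable from `i` along `D`. -/
def reachSet {I : Type*} (D : I → Set I) (i : I) : Set I :=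
  {j | Relation.ReflTransGen (fun a b => b ∈ D a) i j}

theorem countable_reachSet {I : Type*} {D : I → Set I} (hD : ∀ i, (D i).Countable) (i : I) :
    (reachSet D i).Countable := by
  let L : ℕ → Set I := fun n => Nat.rec {i} (fun _ S => ⋃ a ∈ S, D a) n
  have hL : ∀ n, (L n).Countable := by
    intro n
    induction n with
    | zero => exact Set.countable_singleton i
    | succ n ih => exact ih.biUnion fun a _ => hD a
  refine (Set.countable_iUnion hL).mono ?_
  intro j hj
  induction hj with
  | refl => exact Set.mem_iUnion.2 ⟨0, rfl⟩
  | tail _ hbc ih =>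
    obtain ⟨n, hn⟩ := Set.mem_iUnion.1 ih
    exact Set.mem_iUnion.2 ⟨n + 1, Set.mem_biUnion hn hbc⟩

/-- A relation with countable out-neighbourhoods admits a well-order for which every point has
only finitely many earlier in-neighbours. -/
theorem exists_wellOrder_finite_in {I : Type*} (D : I → Set I) (hD : ∀ i, (D i).Countable) :
    ∃ r : I → I → Prop, WellFounded r ∧ (∀ a b, r a b ∨ a = b ∨ r b a) ∧
      (∀ a b c, r a b → r b c → r a c) ∧ ∀ w, {u | r u w ∧ w ∈ D u}.Finite := by
  classical
  let lt : I → I → Prop := WellOrderingRel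
  have hwf : WellFounded lt := WellOrderingRel.isWellOrder.wf
  have hne : ∀ w, {v | w ∈ reachSet D v}.Nonempty := fun w => ⟨w, Relation.ReflTransGen.refl⟩
  let ρ : I → I := fun w => hwf.min _ (hne w)
  have hρ : ∀ w, w ∈ reachSet D (ρ w) := fun w => hwf.min_mem _ (hne w)
  have hidx : ∀ v, ∃ f : I → ℕ, Set.InjOn f (reachSet D v) := fun v =>
    Set.countable_iff_exists_injOn.1 (countable_reachSet hD v)
  choose idx hidx using hidx
  let φ : I → I × ℕ := fun w => (ρ w, idx (ρ w) w)
  have hφ : Function.Injective φ := by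
    intro a b hab
    have h1 : ρ a = ρ b := congrArg Prod.fst hab
    have h2 : idx (ρ a) a = idx (ρ b) b := congrArg Prod.snd hab
    rw [← h1] at h2
    exact hidx (ρ a) (hρ a) (h1 ▸ hρ b) h2
  let s : I × ℕ → I × ℕ → Prop := Prod.Lex lt (· < ·)
  have : IsWellOrder I lt := WellOrderingRel.isWellOrder
  have : IsWellOrder (I × ℕ) s := inferInstanceAs (IsWellOrder (I × ℕ) (Prod.Lex lt (· < ·)))
  refine ⟨fun a b => s (φ a) (φ b), InvImage.wf φ (IsWellFounded.wf (r := s)), ?_, ?_, ?_⟩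
  · intro a b
    rcases trichotomous_of s (φ a) (φ b) with h | h | h
    · exact Or.inl h
    · exact Or.inr (Or.inl (hφ h))
    · exact Or.inr (Or.inr h)
  · intro a b c h1 h2
    exact trans_of s h1 h2
  · intro w
    have key : ∀ u, s (φ u) (φ w) → w ∈ D u → ρ u = ρ w ∧ idx (ρ w) u < idx (ρ w) w := by
      intro u hu hw
      have hmem : w ∈ reachSet D (ρ u) := (hρ u).tail hw
      have hnot : ¬ lt (ρ u) (ρ w) := hwf.not_lt_min (x := ρ u) _ hmem
      rcases (Prod.lex_def).1 hu with h | ⟨h1, h2⟩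
      · exact absurd h hnot
      · have h1' : ρ u = ρ w := h1
        refine ⟨h1', ?_⟩
        have : idx (ρ u) u < idx (ρ w) w := h2
        rwa [h1'] at this
    refine Set.Finite.of_finite_image (f := idx (ρ w)) ?_ ?_
    · refine (Set.finite_lt_nat (idx (ρ w) w)).subset ?_
      rintro _ ⟨u, ⟨hu, hw⟩, rfl⟩
      exact (key u hu hw).2
    · rintro a ⟨ha, ha'⟩ b ⟨hb, hb'⟩ hab
      exact hidx (ρ w) ((key a ha ha').1 ▸ hρ a) ((key b hb hb').1 ▸ hρ b) hab

/-- A colouring avoiding constraints, each of finite scope and each breakable by recolouring any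
single point of its scope. -/
theorem exists_colouring_avoiding {I : Type*} (Bad : I → (I → ℕ) → Prop) (E : I → ℕ → Finset I)
    (hloc : ∀ i (c c' : I → ℕ), c i = c' i → (∀ j ∈ E i (c i), c j = c' j) → Bad i c → Bad i c')
    (hself : ∀ i (c : I → ℕ), {t | ∃ c' : I → ℕ, c' i = t ∧ (∀ j, j ≠ i → c' j = c j) ∧
      Bad i c'}.Finite)
    (hoth : ∀ i (c : I → ℕ), ∀ j ∈ E i (c i), j ≠ i →
      {t | ∃ c' : I → ℕ, c' j = t ∧ (∀ k, k ≠ j → c' k = c k) ∧ Bad i c'}.Finite) :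
    ∃ c : I → ℕ, ∀ i, ¬ Bad i c := by
  classical
  obtain ⟨r, hwf, htri, htrans, hfin⟩ := exists_wellOrder_finite_in
    (fun i => ⋃ κ, (E i κ : Set I)) (fun i => Set.countable_iUnion fun κ => (E i κ).countable_toSet)
  have hirr : ∀ a, ¬ r a a := fun a h => hwf.asymmetric _ _ h h
  let ext : ∀ w, (∀ u, r u w → ℕ) → I → ℕ := fun w p j => if h : r j w then p j h else 0
  let forb : I → (I → ℕ) → Set ℕ := fun w c =>
    {t | ∃ c' : I → ℕ, c' w = t ∧ (∀ j, j ≠ w → c' j = c j) ∧ Bad w c'} ∪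
    ⋃ u ∈ {u | r u w ∧ w ∈ ⋃ κ, (E u κ : Set I)},
      {t | w ∈ E u (c u) ∧ ∃ c' : I → ℕ, c' w = t ∧ (∀ k, k ≠ w → c' k = c k) ∧ Bad u c'}
  have hforb : ∀ w c, (forb w c).Finite := by
    intro w c
    refine (hself w c).union ((hfin w).biUnion ?_)
    intro u hu
    by_cases hw : w ∈ E u (c u)
    · refine (hoth u c w hw ?_).subset fun t ht => ht.2
      rintro rfl
      exact hirr _ hu.1
    · refine Set.finite_empty.subset fun t ht => hw ht.1
  have hex : ∀ w c, ∃ t, t ∉ forb w c := fun w c => (hforb w c).exists_notMem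
  choose pick hpick using hex
  let c : I → ℕ := hwf.fix fun w p => pick w (ext w p)
  have hc : ∀ w, c w = pick w (fun j => if r j w then c j else 0) := by
    intro w
    have : c w = pick w (ext w fun u _ => c u) := hwf.fix_eq _ w
    rw [this]
    congr 1
  refine ⟨c, fun i hbad => ?_⟩
  let S : Finset I := insert i (E i (c i))
  obtain ⟨w, hwS, hwmax⟩ : ∃ w ∈ S, ∀ j ∈ S, j = w ∨ r j w := by
    have : ∀ T : Finset I, T.Nonempty → ∃ w ∈ T, ∀ j ∈ T, j = w ∨ r j w := by
      intro T hT
      induction hT using Finset.Nonempty.cons_induction with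
      | singleton a => exact ⟨a, by simp, by simp⟩
      | cons a s ha hs ih =>
        obtain ⟨w, hw, hmax⟩ := ih
        rcases htri a w with h | h | h
        · refine ⟨w, by simp [hw], ?_⟩
          intro j hj
          rcases Finset.mem_cons.1 hj with rfl | hj
          · exact Or.inr h
          · exact hmax j hj
        · exact absurd (h ▸ hw) ha
        · refine ⟨a, by simp, ?_⟩
          intro j hj
          rcases Finset.mem_cons.1 hj with rfl | hj
          · exact Or.inl rfl
          · rcases hmax j hj with rfl | h'
            · exact Or.inr h
            · exact Or.inr (htrans _ _ _ h' h)
    exact this S ⟨i, Finset.mem_insert_self _ _⟩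
  let c₀ : I → ℕ := fun j => if r j w then c j else 0
  let c' : I → ℕ := Function.update c₀ w (c w)
  have hagree : ∀ j ∈ S, c j = c' j := by
    intro j hj
    rcases hwmax j hj with rfl | h
    · simp [c']
    · have : j ≠ w := by rintro rfl; exact hirr _ h
      simp [c', c₀, this, h]
  have hbad' : Bad i c' := hloc i c c' (hagree i (Finset.mem_insert_self _ _))
    (fun j hj => hagree j (Finset.mem_insert_of_mem hj)) hbad
  have hnf : c w ∉ forb w c₀ := by
    rw [hc w]
    exact hpick w c₀
  have hupd : ∀ j, j ≠ w → c' j = c₀ j := fun j hj => by simp [c', hj]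
  have hcw : c' w = c w := by simp [c']
  rcases Finset.mem_insert.1 hwS with rfl | hwE
  · exact hnf (Or.inl ⟨c', hcw, hupd, hbad'⟩)
  · rcases hwmax i (Finset.mem_insert_self _ _) with rfl | hiw
    · exact hnf (Or.inl ⟨c', hcw, hupd, hbad'⟩)
    · refine hnf (Or.inr (Set.mem_biUnion (x := i) ⟨hiw, Set.mem_iUnion.2 ⟨_, hwE⟩⟩ ?_))
      refine ⟨?_, c', hcw, hupd, hbad'⟩
      have : c₀ i = c i := by simp [c₀, hiw]
      rw [this]
      exact hwE

instance fact_prime_five : Fact (Nat.Prime 5) := ⟨by norm_num⟩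

theorem exists_padicInt_irrational : ∃ γ : ℤ_[5], ∀ M q : ℤ, (M : ℤ_[5]) * γ = q → M = 0 := by
  have h := hensels_lemma (p := 5) (R := ℤ_[5]) (F := (Polynomial.X ^ 2 + 1 : Polynomial ℤ_[5])) (a := 2) (by
    have h1 : ((2 : ℤ_[5]) ^ 2 + 1) = (5 : ℕ) := by norm_num
    have h2 : ‖(2 * 2 : ℤ_[5])‖ = 1 := by
      have : ((2 * 2 : ℤ_[5])) = ((4 : ℤ) : ℤ_[5]) := by norm_num
      rw [this]
      apply le_antisymm (PadicInt.norm_le_one _)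
      by_contra hlt
      push Not at hlt
      have := (PadicInt.norm_int_lt_one_iff_dvd (p := 5) 4).1 hlt
      norm_num at this
    simp only [map_add, map_pow, Polynomial.aeval_X, map_one, Polynomial.derivative_X_pow, Polynomial.derivative_one, map_mul, Polynomial.aeval_C]
    rw [h1, PadicInt.norm_p]
    simp [h2]
    norm_num)
  obtain ⟨γ, hγ, -⟩ := h
  refine ⟨γ, fun M q hM => ?_⟩
  simp only [map_add, map_pow, Polynomial.aeval_X, map_one] at hγ
  have h3 : ((q ^ 2 + M ^ 2 : ℤ) : ℤ_[5]) = 0 := by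
    push_cast
    rw [← hM]
    linear_combination (M : ℤ_[5]) ^ 2 * hγ
  have h4 : q ^ 2 + M ^ 2 = 0 := by exact_mod_cast h3
  nlinarith [sq_nonneg q, sq_nonneg M]

section Padic

variable {p : ℕ} [Fact p.Prime]

theorem PadicInt.exists_int_dvd_sub (z : ℤ_[p]) {n : ℕ} (hn : n ≠ 0) :
    ∃ d : ℤ, (n : ℤ_[p]) ∣ z - d := by
  obtain ⟨k, m, hm, rfl⟩ := Nat.exists_eq_pow_mul_and_not_dvd hn p (Fact.out : p.Prime).ne_one
  have hu : IsUnit (m : ℤ_[p]) := by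
    rw [PadicInt.isUnit_iff]
    apply le_antisymm (PadicInt.norm_le_one _)
    by_contra hlt
    push Not at hlt
    have := (PadicInt.norm_int_lt_one_iff_dvd (p := p) (m : ℤ)).1 (by simpa using hlt)
    exact hm (by exact_mod_cast this)
  refine ⟨(z.appr k : ℕ), ?_⟩
  have h := PadicInt.appr_spec k z
  rw [Ideal.mem_span_singleton] at h
  push_cast
  exact (hu.mul_right_dvd).2 h

theorem PadicInt.exists_factorial_digits (z : ℤ_[p]) :
    ∃ (g : ℕ → ℤ_[p]) (d : ℕ → ℤ), g 0 = z ∧ ∀ k, g k = ((k + 1 : ℕ) : ℤ_[p]) * g (k + 1) + d k := by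
  have h : ∀ (k : ℕ) (w : ℤ_[p]), ∃ (w' : ℤ_[p]) (d : ℤ), w = ((k + 1 : ℕ) : ℤ_[p]) * w' + d := by
    intro k w
    obtain ⟨d, w', hw⟩ := PadicInt.exists_int_dvd_sub w (Nat.succ_ne_zero k)
    exact ⟨w', d, by rw [← hw]; ring⟩
  choose nx dg hnx using h
  let g : ℕ → ℤ_[p] := fun k => Nat.rec z nx k
  exact ⟨g, fun k => dg k (g k), rfl, fun k => hnx k (g k)⟩

theorem PadicInt.eq_zero_of_forall_pow_dvd {z : ℤ_[p]} (h : ∀ e : ℕ, (p : ℤ_[p]) ^ e ∣ z) :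
    z = 0 := by
  rw [← norm_eq_zero]
  have hp : (1 : ℝ) < p := by exact_mod_cast (Fact.out : p.Prime).one_lt
  refine le_antisymm (le_of_forall_pos_le_add fun ε hε => ?_) (norm_nonneg _)
  obtain ⟨e, he⟩ := exists_pow_lt_of_lt_one hε (inv_lt_one_of_one_lt₀ hp)
  have h1 := (PadicInt.norm_le_pow_iff_mem_span_pow z e).2 (Ideal.mem_span_singleton.2 (h e))
  rw [zpow_neg, zpow_natCast, ← inv_pow] at h1
  linarith

theorem PadicInt.eq_zero_of_forall_factorial_dvd {z : ℤ_[p]}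
    (h : ∀ n : ℕ, (n.factorial : ℤ_[p]) ∣ z) : z = 0 := by
  refine PadicInt.eq_zero_of_forall_pow_dvd fun e => dvd_trans ?_ (h (p ^ e))
  have := Nat.dvd_factorial (pow_pos (Fact.out : p.Prime).pos e) le_rfl
  exact_mod_cast Nat.cast_dvd_cast (α := ℤ_[p]) this

theorem PadicInt.tendsto_factorial :
    Filter.Tendsto (fun n : ℕ => ‖(n.factorial : ℤ_[p])‖) Filter.atTop (nhds 0) := by
  rw [Metric.tendsto_atTop]
  intro ε hε
  have hp : (1 : ℝ) < p := by exact_mod_cast (Fact.out : p.Prime).one_lt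
  obtain ⟨e, he⟩ := exists_pow_lt_of_lt_one hε (inv_lt_one_of_one_lt₀ hp)
  refine ⟨p ^ e, fun n hn => ?_⟩
  have h0 : (p ^ e) ∣ n.factorial := Nat.dvd_factorial (pow_pos (Fact.out : p.Prime).pos e) hn
  have h1 := (PadicInt.norm_le_pow_iff_mem_span_pow (n.factorial : ℤ_[p]) e).2
    (Ideal.mem_span_singleton.2 (by exact_mod_cast Nat.cast_dvd_cast (α := ℤ_[p]) h0))
  rw [zpow_neg, zpow_natCast, ← inv_pow] at h1
  rw [dist_zero_right, norm_norm]
  linarith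

/-- Every inhomogeneous linear system `τ k = (k + 1) τ (k + 1) + t k` is solvable in `ℤ_[p]`. -/
theorem PadicInt.exists_solution (t : ℕ → ℤ_[p]) :
    ∃ τ : ℕ → ℤ_[p], ∀ k, τ k = ((k + 1 : ℕ) : ℤ_[p]) * τ (k + 1) + t k := by
  have hs : ∀ k, Summable fun j => ((k + 1).ascFactorial j : ℤ_[p]) * t (k + j) := by
    intro k
    refine NonarchimedeanAddGroup.summable_of_tendsto_cofinite_zero ?_
    rw [Nat.cofinite_eq_atTop]
    refine squeeze_zero_norm (fun j => ?_) (PadicInt.tendsto_factorial (p := p))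
    obtain ⟨m, hm⟩ := Nat.factorial_dvd_ascFactorial (k + 1) j
    rw [hm, norm_mul, Nat.cast_mul, norm_mul, mul_assoc]
    refine mul_le_of_le_one_right (norm_nonneg _) (mul_le_one₀ (PadicInt.norm_le_one _) (norm_nonneg _) (PadicInt.norm_le_one _))
  refine ⟨fun k => ∑' j, ((k + 1).ascFactorial j : ℤ_[p]) * t (k + j), fun k => ?_⟩
  show (∑' j, ((k + 1).ascFactorial j : ℤ_[p]) * t (k + j)) = _
  rw [(hs k).tsum_eq_zero_add, ← (hs (k + 1)).tsum_mul_left, add_comm]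
  congr 1
  · refine tsum_congr fun j => ?_
    have : (k + 1).ascFactorial (j + 1) = (k + 1) * (k + 1 + 1).ascFactorial j := by
      rw [Nat.ascFactorial_succ, ← Nat.succ_ascFactorial]
    rw [this, Nat.cast_mul, show k + (j + 1) = k + 1 + j by ring]
    ring
  · simp

end Padic

theorem eq_sum_factorial_add {A : Type*} [AddCommGroup A] {y s : ℕ → A}
    (h : ∀ k, y k = (k + 1) • y (k + 1) + s k) (n : ℕ) :
    y 0 = ∑ j ∈ Finset.range n, j.factorial • s j + n.factorial • y n := by
  induction n with
  | zero => simp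
  | succ n ih =>
    rw [ih, Finset.sum_range_succ, h n, smul_add, ← mul_smul, Nat.factorial_succ,
      mul_comm n.factorial]
    abel

/-- Diagonal construction of a sequence meeting local requirements. -/
theorem exists_seq_of_local {A : Type*} [Nonempty A] (Q : ℕ → (ℕ → A) → Prop)
    (hloc : ∀ k (η η' : ℕ → A), (∀ j ≤ k, η j = η' j) → Q k η → Q k η')
    (hex : ∀ k (η : ℕ → A), ∃ a, Q k (Function.update η k a)) : ∃ η : ℕ → A, ∀ k, Q k η := by
  choose f hf using hex
  let a₀ : A := Classical.arbitrary A
  let s : ℕ → ℕ → A := fun k => Nat.rec (fun _ => a₀) (fun k η => Function.update η k (f k η)) k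
  have hstep : ∀ k, s (k + 1) = Function.update (s k) k (f k (s k)) := fun k => rfl
  have hstab : ∀ j k, j < k → s k j = s (j + 1) j := by
    intro j k hjk
    induction k, hjk using Nat.le_induction with
    | base => rfl
    | succ k hk ih =>
      rw [hstep, Function.update_of_ne (by omega), ih]
  refine ⟨fun k => s (k + 1) k, fun k => hloc k (s (k + 1)) _ (fun j hj => ?_) ?_⟩
  · exact hstab j (k + 1) (by omega)
  · rw [hstep]; exact hf k (s k)

section Representation

variable {p : ℕ} [Fact p.Prime] {Λ I : Type*}

variable (p Λ) in
/-- Finitely supported integral functions as `p`-adic ones. -/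
noncomputable def coePadic : (Λ →₀ ℤ) →ₗ[ℤ] (Λ → ℤ_[p]) where
  toFun b l := b l
  map_add' a b := by ext l; simp
  map_smul' m b := by ext l; simp

@[simp] theorem coePadic_apply (b : Λ →₀ ℤ) (l : Λ) : coePadic p Λ b l = b l := rfl

variable (p Λ) in
/-- The submodule of finitely supported `p`-adic functions. -/
def finSupported : Submodule ℤ_[p] (Λ → ℤ_[p]) where
  carrier := {v | (Function.support v).Finite}
  zero_mem' := by simp
  add_mem' ha hb := (ha.union hb).subset (Function.support_add _ _)
  smul_mem' r v hv := Set.Finite.subset hv fun l hl => by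
    simp only [Function.mem_support, Pi.smul_apply, smul_eq_mul] at hl ⊢
    exact right_ne_zero_of_mul hl

theorem coePadic_mem_finSupported (b : Λ →₀ ℤ) : coePadic p Λ b ∈ finSupported p Λ :=
  Set.Finite.subset b.hasFiniteSupport fun l hl => by
    simp only [Function.mem_support, coePadic_apply] at hl ⊢
    exact_mod_cast hl

/-- The coloured combination `∑ n j • (Y j + c j γ x j)`. -/
noncomputable def colouredComb (Y : I → Λ → ℤ_[p]) (x : I → Λ →₀ ℤ) (γ : ℤ_[p]) (c : I → ℕ) :
    (I →₀ ℤ) →ₗ[ℤ] (Λ → ℤ_[p]) :=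
  Finsupp.linearCombination ℤ fun j => Y j + ((c j : ℤ_[p]) * γ) • coePadic p Λ (x j)

/-- A nonzero multiple of `h` is an integral function plus a coloured combination. -/
def IsRep (Y : I → Λ → ℤ_[p]) (x : I → Λ →₀ ℤ) (γ : ℤ_[p]) (c : I → ℕ) (h : Λ → ℤ_[p])
    (M : ℤ) (b : Λ →₀ ℤ) (n : I →₀ ℤ) : Prop :=
  M ≠ 0 ∧ M • h = coePadic p Λ b + colouredComb Y x γ c n

variable {Y : I → Λ → ℤ_[p]} {x : I → Λ →₀ ℤ} {γ : ℤ_[p]} {c c' : I → ℕ} {h h' : Λ → ℤ_[p]}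
  {M M' : ℤ} {b b' : Λ →₀ ℤ} {n n' : I →₀ ℤ}

theorem colouredComb_congr (hc : ∀ j ∈ n.support, c j = c' j) :
    colouredComb Y x γ c n = colouredComb Y x γ c' n := by
  simp only [colouredComb, Finsupp.linearCombination_apply]
  exact Finset.sum_congr rfl fun j hj => by simp only [hc j hj]

theorem colouredComb_sub_of_eq_off {j : I} (hc : ∀ k, k ≠ j → c k = c' k) :
    colouredComb Y x γ c n - colouredComb Y x γ c' n =
      n j • (((c j : ℤ_[p]) - c' j) * γ) • coePadic p Λ (x j) := by
  classical
  simp only [colouredComb, Finsupp.linearCombination_apply, Finsupp.sum]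
  rw [← Finset.sum_sub_distrib, Finset.sum_eq_single j]
  · rw [← smul_sub, add_sub_add_left_eq_sub, ← sub_smul, sub_mul]
  · intro k _ hk
    rw [hc k hk, sub_self]
  · intro hj
    simp [Finsupp.notMem_support_iff.1 hj]

/-- Coefficients viewed in `ℤ_[p]`. -/
noncomputable def castCoeff (n : I →₀ ℤ) : I →₀ ℤ_[p] :=
  n.mapRange (Int.cast : ℤ → ℤ_[p]) Int.cast_zero

theorem mkQ_colouredComb (n : I →₀ ℤ) :
    (finSupported p Λ).mkQ (colouredComb Y x γ c n) =
      Finsupp.linearCombination ℤ_[p] (fun j => (finSupported p Λ).mkQ (Y j)) (castCoeff n) := by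
  classical
  simp only [colouredComb, Finsupp.linearCombination_apply, castCoeff]
  rw [Finsupp.sum_mapRange_index (by simp), Finsupp.sum, Finsupp.sum, map_sum]
  refine Finset.sum_congr rfl fun j _ => ?_
  have h0 : (finSupported p Λ).mkQ (((c j : ℤ_[p]) * γ) • coePadic p Λ (x j)) = 0 := by
    rw [Submodule.mkQ_apply, Submodule.Quotient.mk_eq_zero]
    exact Submodule.smul_mem _ _ (coePadic_mem_finSupported _)
  rw [map_zsmul, map_add, h0, add_zero, Int.cast_smul_eq_zsmul]

theorem IsRep.smul_mkQ (hr : IsRep Y x γ c h M b n) :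
    (M : ℤ_[p]) • (finSupported p Λ).mkQ h =
      Finsupp.linearCombination ℤ_[p] (fun j => (finSupported p Λ).mkQ (Y j)) (castCoeff n) := by
  have h0 : (finSupported p Λ).mkQ (coePadic p Λ b) = 0 := by
    rw [Submodule.mkQ_apply, Submodule.Quotient.mk_eq_zero]
    exact coePadic_mem_finSupported _
  rw [Int.cast_smul_eq_zsmul, ← map_zsmul, hr.2, map_add, h0, zero_add, mkQ_colouredComb]

section

variable (hY : LinearIndependent ℤ_[p] fun j => (finSupported p Λ).mkQ (Y j))
include hY

theorem IsRep.coeff_eq (hr : IsRep Y x γ c h M b n) (hr' : IsRep Y x γ c' h M' b' n') (j : I) :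
    M' * n j = M * n' j := by
  have h1 : Finsupp.linearCombination ℤ_[p] (fun j => (finSupported p Λ).mkQ (Y j))
      ((M' : ℤ_[p]) • castCoeff n) =
      Finsupp.linearCombination ℤ_[p] (fun j => (finSupported p Λ).mkQ (Y j))
      ((M : ℤ_[p]) • castCoeff n') := by
    rw [map_smul, map_smul, ← hr.smul_mkQ, ← hr'.smul_mkQ, smul_comm]
  have h2 := DFunLike.congr_fun (hY h1) j
  simp only [castCoeff, Finsupp.smul_apply, Finsupp.mapRange_apply, smul_eq_mul] at h2
  exact_mod_cast h2

theorem IsRep.support_eq (hr : IsRep Y x γ c h M b n) (hr' : IsRep Y x γ c' h M' b' n') :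
    n.support = n'.support := by
  ext j
  have := hr.coeff_eq hY hr' j
  rw [Finsupp.mem_support_iff, Finsupp.mem_support_iff]
  constructor
  · intro h0 h1
    rw [h1, mul_zero] at this
    exact (mul_ne_zero hr'.1 h0) this
  · intro h0 h1
    rw [h1, mul_zero] at this
    exact (mul_ne_zero hr.1 h0) this.symm

variable (hγ : ∀ M q : ℤ, (M : ℤ_[p]) * γ = q → M = 0) (hx : ∀ i, x i ≠ 0)
include hγ hx

/-- Recolouring a point of the support destroys a representation. -/
theorem IsRep.coeff_eq_zero (hr : IsRep Y x γ c h M b n) (hr' : IsRep Y x γ c' h M' b' n')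
    {j : I} (hc : ∀ k, k ≠ j → c k = c' k) (hj : c j ≠ c' j) : n j = 0 := by
  have hn : M' • n = M • n' := by
    ext k
    simpa using hr.coeff_eq hY hr' k
  have h1 : M' • (M • h) = M • (M' • h) := smul_comm _ _ _
  rw [hr.2, hr'.2, smul_add, smul_add, ← map_smul (colouredComb Y x γ c),
    ← map_smul (colouredComb Y x γ c'), ← hn] at h1
  have h2 := colouredComb_sub_of_eq_off (Y := Y) (x := x) (γ := γ) (n := M' • n) hc
  obtain ⟨l, hl⟩ := Finsupp.ne_iff.1 (hx j)
  have h3 := congrFun h1 l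
  have h4 := congrFun h2 l
  simp only [Pi.add_apply, Pi.sub_apply, Pi.smul_apply, coePadic_apply] at h3 h4
  simp only [Finsupp.smul_apply, zsmul_eq_mul, smul_eq_mul, Int.cast_mul] at h3 h4
  have h5 := hγ (M' * n j * ((c j : ℤ) - c' j) * x j l) (M * b' l - M' * b l) (by
    push_cast at h4 ⊢
    linear_combination h3 - h4)
  have h6 : (c j : ℤ) - c' j ≠ 0 := by
    rw [sub_ne_zero]; exact_mod_cast hj
  simp only [mul_eq_zero, hr'.1, h6, Finsupp.coe_zero, Pi.zero_apply] at h5 hl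
  tauto

omit hx in
theorem exists_smul_eq_smul_of_two_reps {ζ υ : Λ → ℤ_[p]} {P : ℤ} {β : Λ →₀ ℤ} {π : I →₀ ℤ}
    {i : I}
    (hr : IsRep Y x γ c (ζ + ((c i : ℤ_[p]) * γ) • υ) M b n)
    (hr' : IsRep Y x γ c' (ζ + ((c' i : ℤ_[p]) * γ) • υ) M' b' n')
    (hυ : IsRep Y x γ c υ P β π) (hc : ∀ k, k ≠ i → c k = c' k) (hi : c i ≠ c' i) :
    ∃ M q : ℤ, M ≠ 0 ∧ M • υ = q • coePadic p Λ (x i) := by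
  have hδ : (c i : ℤ) - c' i ≠ 0 := by
    rw [sub_ne_zero]; exact_mod_cast hi
  have e1 : ∀ j, P * M' * n j - P * M * n' j = 0 ∧ π j = 0 := by
    intro j
    have h1 : Finsupp.linearCombination ℤ_[p] (fun j => (finSupported p Λ).mkQ (Y j))
        (((P * M' : ℤ) : ℤ_[p]) • castCoeff n - ((P * M : ℤ) : ℤ_[p]) • castCoeff n') =
        Finsupp.linearCombination ℤ_[p] (fun j => (finSupported p Λ).mkQ (Y j))
        ((((M * M' * ((c i : ℤ) - c' i) : ℤ) : ℤ_[p]) * γ) • castCoeff π) := by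
      rw [map_sub, map_smul, map_smul, map_smul, ← hr.smul_mkQ, ← hr'.smul_mkQ, ← hυ.smul_mkQ]
      simp only [map_add, map_smul]
      push_cast
      module
    have h2 := DFunLike.congr_fun (hY h1) j
    simp only [castCoeff, Finsupp.smul_apply, Finsupp.sub_apply, Finsupp.mapRange_apply,
      smul_eq_mul] at h2
    have h3 := hγ (M * M' * ((c i : ℤ) - c' i) * π j) (P * M' * n j - P * M * n' j) (by
      push_cast at h2 ⊢
      linear_combination -h2)
    have h4 : π j = 0 := by
      simpa [hr.1, hr'.1, hδ] using h3
    refine ⟨?_, h4⟩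
    rw [h4] at h2
    simp only [Int.cast_zero, mul_zero] at h2
    exact_mod_cast h2
  have hπ : π = 0 := by ext j; exact (e1 j).2
  have hn : (P * M') • n = (P * M) • n' := by
    ext j
    simpa [sub_eq_zero] using (e1 j).1
  have hυ2 := hυ.2
  rw [hπ, map_zero, add_zero] at hυ2
  refine ⟨M * M' * P, P * M' * n i, mul_ne_zero (mul_ne_zero hr.1 hr'.1) hυ.1, ?_⟩
  have h2 := colouredComb_sub_of_eq_off (Y := Y) (x := x) (γ := γ) (n := (P * M') • n) hc
  have h3 : (P * M') • colouredComb Y x γ c n - (P * M) • colouredComb Y x γ c' n' =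
      ((P * M') • n) i • (((c i : ℤ_[p]) - c' i) * γ) • coePadic p Λ (x i) := by
    rw [← h2, ← map_smul, ← map_smul, ← hn]
  ext l
  have f1 := congrFun hr.2 l
  have f2 := congrFun hr'.2 l
  have f3 := congrFun hυ2 l
  have f4 := congrFun h3 l
  simp only [Pi.add_apply, Pi.sub_apply, Pi.smul_apply, coePadic_apply] at f1 f2 f3 f4 ⊢
  simp only [Finsupp.smul_apply, zsmul_eq_mul, smul_eq_mul, Int.cast_mul] at f1 f2 f3 f4 ⊢
  have h5 := hγ (((c i : ℤ) - c' i) * (M * M' * β l - P * M' * n i * x i l) )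
    (P * M' * b l - P * M * b' l) (by
      push_cast
      linear_combination (P : ℤ_[p]) * M' * f1 - (P : ℤ_[p]) * M * f2 + f4 -
        (M : ℤ_[p]) * M' * ((c i : ℤ_[p]) - c' i) * γ * f3)
  have h6 : (M * M' * β l : ℤ) - P * M' * n i * x i l = 0 := by
    simpa [hδ] using h5
  have h7 : (M : ℤ_[p]) * M' * β l - P * M' * n i * x i l = 0 := by exact_mod_cast h6
  linear_combination (M : ℤ_[p]) * M' * f3 + h7

/-- A colouring for which no pair `ζ i + c i γ υ i`, `υ i` is represented, unless `υ i` is a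
rational multiple of `x i`. -/
theorem exists_colouring_not_isRep (ζ υ : I → Λ → ℤ_[p]) :
    ∃ c : I → ℕ, ∀ i, ∀ M b n M' b' n',
      IsRep Y x γ c (ζ i + ((c i : ℤ_[p]) * γ) • υ i) M b n → IsRep Y x γ c (υ i) M' b' n' →
      ∃ M q : ℤ, M ≠ 0 ∧ M • υ i = q • coePadic p Λ (x i) := by
  classical
  let Rep : (I → ℕ) → (Λ → ℤ_[p]) → Finset I → Prop := fun c h E =>
    ∃ M b n, IsRep Y x γ c h M b n ∧ n.support = E
  have huniq : ∀ c c' h E E', Rep c h E → Rep c' h E' → E = E' := by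
    rintro c c' h E E' ⟨M, b, n, hr, rfl⟩ ⟨M', b', n', hr', rfl⟩
    exact hr.support_eq hY hr'
  have hS : ∀ h, ∃ E : Finset I, ∀ c E', Rep c h E' → E' = E := by
    intro h
    by_cases hh : ∃ c E, Rep c h E
    · obtain ⟨c, E, hE⟩ := hh
      exact ⟨E, fun c' E' hE' => huniq c' c h E' E hE' hE⟩
    · exact ⟨∅, fun c E' hE' => (hh ⟨c, E', hE'⟩).elim⟩
  choose S hS using hS
  let comb : I → ℕ → Λ → ℤ_[p] := fun i κ => ζ i + ((κ : ℤ_[p]) * γ) • υ i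
  suffices hmain : ∃ c : I → ℕ, ∀ i, ¬ ((∃ E, Rep c (comb i (c i)) E) ∧ (∃ E, Rep c (υ i) E) ∧
      ¬ ∃ M q : ℤ, M ≠ 0 ∧ M • υ i = q • coePadic p Λ (x i)) by
    obtain ⟨c, hc⟩ := hmain
    refine ⟨c, fun i M b n M' b' n' hr hr' => ?_⟩
    by_contra hcon
    exact hc i ⟨⟨_, M, b, n, hr, rfl⟩, ⟨_, M', b', n', hr', rfl⟩, hcon⟩
  refine exists_colouring_avoiding (fun i c => (∃ E, Rep c (comb i (c i)) E) ∧
      (∃ E, Rep c (υ i) E) ∧ ¬ ∃ M q : ℤ, M ≠ 0 ∧ M • υ i = q • coePadic p Λ (x i))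
    (fun i κ => S (comb i κ) ∪ S (υ i)) ?_ ?_ ?_
  · rintro i c c' hi hE ⟨⟨E, hrE⟩, ⟨E', hrE'⟩, hq⟩
    have transfer : ∀ h E, (∀ j ∈ S h, c j = c' j) → Rep c h E → Rep c' h E := by
      intro h E hE hr
      have hES := hS h c E hr
      obtain ⟨M, b, n, hr, rfl⟩ := hr
      refine ⟨M, b, n, ⟨hr.1, ?_⟩, rfl⟩
      rw [hr.2, colouredComb_congr fun j hj => hE j (hES ▸ hj)]
    refine ⟨⟨E, ?_⟩, ⟨E', ?_⟩, hq⟩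
    · rw [← hi]
      exact transfer _ _ (fun j hj => hE j (Finset.mem_union_left _ hj)) hrE
    · exact transfer _ _ (fun j hj => hE j (Finset.mem_union_right _ hj)) hrE'
  · intro i c
    refine Set.Subsingleton.finite ?_
    rintro t ⟨c₁, rfl, hc₁, ⟨E₁, M₁, b₁, n₁, hr₁, -⟩, ⟨E₃, P, β, π, hr₃, -⟩, hq⟩
      t' ⟨c₂, rfl, hc₂, ⟨E₂, M₂, b₂, n₂, hr₂, -⟩, -, -⟩
    by_contra hne
    exact hq (exists_smul_eq_smul_of_two_reps hY hγ hr₁ hr₂ hr₃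
      (fun k hk => (hc₁ k hk).trans (hc₂ k hk).symm) hne)
  · intro i c j hj hji
    refine Set.Subsingleton.finite ?_
    rintro t ⟨c₁, rfl, hc₁, ⟨E₁, hE₁⟩, ⟨E₃, hE₃⟩, -⟩
      t' ⟨c₂, rfl, hc₂, ⟨E₂, hE₂⟩, ⟨E₄, hE₄⟩, -⟩
    by_contra hne
    have main : ∀ h E E', j ∈ S h → Rep c₁ h E → Rep c₂ h E' → False := by
      intro h E E' hjS hr hr'
      rw [← hS h c₁ E hr] at hjS
      obtain ⟨M, b, n, hr, rfl⟩ := hr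
      obtain ⟨M', b', n', hr', rfl⟩ := hr'
      exact Finsupp.mem_support_iff.1 hjS (hr.coeff_eq_zero hY hγ hx hr'
        (fun k hk => (hc₁ k hk).trans (hc₂ k hk).symm) hne)
    have e₁ : c₁ i = c i := hc₁ i hji.symm
    have e₂ : c₂ i = c i := hc₂ i hji.symm
    rw [e₁] at hE₁
    rw [e₂] at hE₂
    rcases Finset.mem_union.1 hj with h | h
    · exact main _ _ _ h hE₁ hE₂
    · exact main _ _ _ h hE₃ hE₄

end

end Representation

section Branches

/-- One step of a branch: two labels, a level, a payload, and the data to be killed. -/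
@[ext] structure Move (Λ K : Type*) where
  a : Λ
  b : Λ
  lev : ℕ
  pay : K × (Λ →₀ ℤ)
  u : Λ →₀ ℤ
  v : Λ →₀ ℤ
  x : Λ →₀ ℤ

variable {Λ K : Type*}

/-- The first `k` moves of a branch. -/
def initialMoves (η : ℕ → Move Λ K) (k : ℕ) : List (Move Λ K) := (List.range k).map η

variable (J : Λ ≃ List (Move Λ K) × ℕ × Λ)

/-- The level at which a point is placed by the coding `J`. -/
def nodeRank (l : Λ) : ℕ := (J l).2.1

/-- The point of level `lev (η k)` and label `a` over the first `k` moves of `η`. -/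
def node (η : ℕ → Move Λ K) (k : ℕ) (a : Λ) : Λ := J.symm (initialMoves η k, (η k).lev, a)

/-- The difference of the two basis elements selected at step `k`. -/
noncomputable def marker (η : ℕ → Move Λ K) (k : ℕ) : Λ →₀ ℤ :=
  Finsupp.single (node J η k (η k).a) 1 - Finsupp.single (node J η k (η k).b) 1

/-- Admissible sequences of moves. -/
structure IsBranch (η : ℕ → Move Λ K) : Prop where
  ne : ∀ k, (η k).a ≠ (η k).b
  strictMono : StrictMono fun k => (η k).lev
  rank_lt : ∀ k, ∀ l ∈ (η k).pay.2.support, nodeRank J l < (η k).lev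
  x_ne : (η 0).x ≠ 0

variable {J}

theorem initialMoves_length (η : ℕ → Move Λ K) (k : ℕ) : (initialMoves η k).length = k := by
  simp [initialMoves]

theorem nodeRank_node (η : ℕ → Move Λ K) (k : ℕ) (a : Λ) :
    nodeRank J (node J η k a) = (η k).lev := by
  simp [nodeRank, node]

theorem node_inj {η θ : ℕ → Move Λ K} {k m : ℕ} {a b : Λ} (h : node J η k a = node J θ m b) :
    k = m ∧ initialMoves η k = initialMoves θ k ∧ a = b := by
  have h1 := J.symm.injective h
  simp only [Prod.mk.injEq] at h1
  have h2 := congrArg List.length h1.1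
  rw [initialMoves_length, initialMoves_length] at h2
  subst h2
  exact ⟨rfl, h1.1, h1.2.2⟩

theorem marker_node_self {η : ℕ → Move Λ K} {k : ℕ} (h : (η k).a ≠ (η k).b) :
    marker J η k (node J η k (η k).a) = 1 := by
  classical
  have : node J η k (η k).b ≠ node J η k (η k).a := fun e => h (node_inj e).2.2.symm
  simp [marker, this]

theorem marker_node_of_ne {η θ : ℕ → Move Λ K} {k m : ℕ} {a : Λ}
    (h : m = k → initialMoves η k ≠ initialMoves θ k) :
    marker J θ m (node J η k a) = 0 := by
  classical
  have key : ∀ b, node J θ m b ≠ node J η k a := by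
    intro b e
    obtain ⟨rfl, h2, -⟩ := node_inj e
    exact h rfl h2.symm
  simp [marker, key]

theorem eventually_initialMoves_ne {η θ : ℕ → Move Λ K} (h : η ≠ θ) :
    ∀ᶠ k in Filter.atTop, initialMoves η k ≠ initialMoves θ k := by
  obtain ⟨m, hm⟩ := Function.ne_iff.1 h
  filter_upwards [Filter.eventually_gt_atTop m] with k hk e
  exact hm (List.map_inj_left.1 e m (List.mem_range.2 hk))

variable {p : ℕ} [Fact p.Prime]

/-- The branch elements are independent over `ℤ_[p]` modulo finitely supported functions. -/
theorem linearIndependent_branches (Y : {η // IsBranch J η} → ℕ → Λ → ℤ_[p])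
    (hY : ∀ i k, Y i k = (k + 1) • Y i (k + 1) +
      coePadic p Λ (marker J i.1 k + (i.1 k).pay.2)) :
    LinearIndependent ℤ_[p] fun i => (finSupported p Λ).mkQ (Y i 0) := by
  classical
  rw [linearIndependent_iff]
  intro r hr
  by_contra hr0
  set S := r.support with hS
  have hSne : S.Nonempty := Finsupp.support_nonempty_iff.2 hr0
  set v : Λ → ℤ_[p] := ∑ i ∈ S, r i • Y i 0 with hv
  have hvfin : (Function.support v).Finite := by
    have : (finSupported p Λ).mkQ v = 0 := by
      rw [← hr, Finsupp.linearCombination_apply, hv, map_sum]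
      rfl
    rw [Submodule.mkQ_apply, Submodule.Quotient.mk_eq_zero] at this
    exact this
  have hsep : ∀ᶠ k in Filter.atTop, ∀ i ∈ S, ∀ j ∈ S, j ≠ i →
      initialMoves i.1 k ≠ initialMoves j.1 k := by
    rw [Filter.eventually_all_finset]
    intro i _
    rw [Filter.eventually_all_finset]
    intro j _
    by_cases h : j = i
    · exact Filter.Eventually.of_forall fun k h' => (h' h).elim
    · filter_upwards [eventually_initialMoves_ne (fun e => h (Subtype.ext e.symm) :
        i.1 ≠ j.1)] with k hk _
      exact hk
  have hrank : ∀ᶠ k in Filter.atTop, ∀ l ∈ hvfin.toFinset, nodeRank J l < k := by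
    rw [Filter.eventually_all_finset]
    intro l _
    exact Filter.eventually_gt_atTop _
  have hdvd : ∀ᶠ k : ℕ in Filter.atTop, ((k + 1 : ℕ) : ℤ_[p]) ∣ ∏ i ∈ S, r i := by
    filter_upwards [hsep, hrank] with k hsep hrank
    obtain ⟨i, hiS, hmax⟩ := S.exists_max_image (fun j => (j.1 k).lev) hSne
    refine dvd_trans ?_ (Finset.dvd_prod_of_mem r hiS)
    set P := node J i.1 k (i.1 k).a with hP
    have hvP : v P = 0 := by
      by_contra hne
      have h1 := hrank P (by simpa using hne)
      rw [hP, nodeRank_node] at h1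
      exact absurd (i.2.strictMono.le_apply (x := k)) (not_le.2 h1)
    have hpay : ∀ j ∈ S, ∀ m ≤ k, (j.1 m).pay.2 P = 0 := by
      intro j hj m hm
      by_contra hne
      have h1 := j.2.rank_lt m P (Finsupp.mem_support_iff.2 hne)
      rw [hP, nodeRank_node] at h1
      have h2 : (j.1 m).lev ≤ (j.1 k).lev := j.2.strictMono.monotone hm
      have h3 := hmax j hj
      omega
    have hval : ∀ j ∈ S, Y j 0 P = (if j = i then (k.factorial : ℤ_[p]) else 0) +
        ((k + 1).factorial : ℤ_[p]) * Y j (k + 1) P := by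
      intro j hj
      have h1 := congrFun (eq_sum_factorial_add (hY j) (k + 1)) P
      rw [h1, Pi.add_apply, Finset.sum_apply, Pi.smul_apply, nsmul_eq_mul]
      congr 1
      rw [Finset.sum_range_succ, Finset.sum_eq_zero]
      · rw [zero_add, Pi.smul_apply, coePadic_apply, Finsupp.add_apply, hpay j hj k le_rfl, add_zero]
        split_ifs with hji
        · subst hji
          rw [marker_node_self (j.2.ne k)]
          simp
        · rw [marker_node_of_ne fun _ => hsep i hiS j hj hji]
          simp
      · intro m hm
        have hm := Finset.mem_range.1 hm
        rw [Pi.smul_apply, coePadic_apply, Finsupp.add_apply, hpay j hj m hm.le, add_zero,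
          marker_node_of_ne fun e => absurd e hm.ne]
        simp
    have h2 : v P = (k.factorial : ℤ_[p]) * r i +
        (k.factorial : ℤ_[p]) * (((k + 1 : ℕ) : ℤ_[p]) * ∑ j ∈ S, r j * Y j (k + 1) P) := by
      rw [hv, Finset.sum_apply]
      have : ∀ j ∈ S, (r j • Y j 0) P = (if j = i then (k.factorial : ℤ_[p]) * r i else 0) +
          (k.factorial : ℤ_[p]) * (((k + 1 : ℕ) : ℤ_[p]) * (r j * Y j (k + 1) P)) := by
        intro j hj
        rw [Pi.smul_apply, hval j hj, smul_eq_mul, Nat.factorial_succ]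
        split_ifs with hji
        · subst hji
          push_cast; ring
        · push_cast; ring
      rw [Finset.sum_congr rfl this, Finset.sum_add_distrib, Finset.sum_ite_eq' S i, if_pos hiS,
        ← Finset.mul_sum, ← Finset.mul_sum]
    rw [hvP, ← mul_add, eq_comm, mul_eq_zero] at h2
    have h3 := h2.resolve_left (by exact_mod_cast k.factorial_ne_zero)
    exact ⟨-∑ j ∈ S, r j * Y j (k + 1) P, by linear_combination h3⟩
  have hprod : ∏ i ∈ S, r i = 0 := by
    refine PadicInt.eq_zero_of_forall_pow_dvd fun e => ?_
    obtain ⟨N, hN⟩ := Filter.eventually_atTop.1 hdvd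
    have hp := (Fact.out : p.Prime).one_lt
    have h1 : N + 1 + e < p ^ (N + 1 + e) := Nat.lt_pow_self hp
    have h2 := hN (p ^ (N + 1 + e) - 1) (by omega)
    rw [Nat.sub_add_cancel (by omega), Nat.cast_pow] at h2
    exact dvd_trans (pow_dvd_pow _ (by omega)) h2
  obtain ⟨i, hi, h0⟩ := Finset.prod_eq_zero_iff.1 hprod
  exact Finsupp.mem_support_iff.1 hi h0

end Branches

section Systems

variable {Λ K : Type*}

/-- Branch elements together with a colouring that defeats the data carried by each branch. -/
structure BranchSystem (J : Λ ≃ List (Move Λ K) × ℕ × Λ) where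
  /-- The branch elements. -/
  Y : {η // IsBranch J η} → ℕ → Λ → ℤ_[5]
  /-- An irrational `5`-adic integer. -/
  γ : ℤ_[5]
  /-- The colouring of the branches. -/
  c : {η // IsBranch J η} → ℕ
  /-- The successive factorial quotients of `γ`. -/
  g : ℕ → ℤ_[5]
  /-- The factorial digits of `γ`. -/
  d : ℕ → ℤ
  Y_eq : ∀ i k, Y i k = (k + 1) • Y i (k + 1) +
    coePadic 5 Λ (marker J i.1 k + (i.1 k).pay.2)
  g_zero : g 0 = γ
  g_eq : ∀ k, g k = ((k + 1 : ℕ) : ℤ_[5]) * g (k + 1) + d k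
  eq_smul_of_isRep : ∀ i (ζ υ : Λ → ℤ_[5]),
    (∀ k, ∃ w, ζ = coePadic 5 Λ (i.1 k).u + k.factorial • w) →
    (∀ k, ∃ w, υ = coePadic 5 Λ (i.1 k).v + k.factorial • w) →
    ∀ M b n M' b' n',
      IsRep (fun j => Y j 0) (fun j => (j.1 0).x) γ c (ζ + ((c i : ℤ_[5]) * γ) • υ) M b n →
      IsRep (fun j => Y j 0) (fun j => (j.1 0).x) γ c υ M' b' n' →
      ∃ M q : ℤ, M ≠ 0 ∧ M • υ = q • coePadic 5 Λ (i.1 0).x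

theorem eq_of_forall_factorial_approx {p : ℕ} [Fact p.Prime] {s : ℕ → Λ → ℤ_[p]}
    {z z' : Λ → ℤ_[p]}
    (h : ∀ k, ∃ w, z = s k + k.factorial • w) (h' : ∀ k, ∃ w, z' = s k + k.factorial • w) :
    z = z' := by
  ext l
  rw [← sub_eq_zero]
  refine PadicInt.eq_zero_of_forall_factorial_dvd fun n => ?_
  obtain ⟨w, hw⟩ := h n
  obtain ⟨w', hw'⟩ := h' n
  refine ⟨w l - w' l, ?_⟩
  rw [hw, hw']
  simp only [Pi.add_apply, Pi.smul_apply]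
  simp only [nsmul_eq_mul]
  ring

theorem nonempty_branchSystem (J : Λ ≃ List (Move Λ K) × ℕ × Λ) :
    Nonempty (BranchSystem J) := by
  classical
  obtain ⟨γ, hγ⟩ := exists_padicInt_irrational
  obtain ⟨g, d, hg0, hg⟩ := PadicInt.exists_factorial_digits γ
  have hY : ∀ i : {η // IsBranch J η}, ∃ Y : ℕ → Λ → ℤ_[5], ∀ k, Y k = (k + 1) • Y (k + 1) +
      coePadic 5 Λ (marker J i.1 k + (i.1 k).pay.2) := by
    intro i
    have h := fun l => PadicInt.exists_solution (p := 5)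
      fun k => coePadic 5 Λ (marker J i.1 k + (i.1 k).pay.2) l
    choose τ hτ using h
    refine ⟨fun k l => τ l k, fun k => funext fun l => ?_⟩
    rw [Pi.add_apply, Pi.smul_apply, nsmul_eq_mul]
    exact hτ l k
  choose Y hY using hY
  have hind := linearIndependent_branches Y hY
  have hlim : ∀ s : ℕ → Λ → ℤ_[5], ∃ z, ∀ z', (∀ k, ∃ w, z' = s k + k.factorial • w) → z' = z := by
    intro s
    by_cases h : ∃ z, ∀ k, ∃ w, z = s k + k.factorial • w
    · obtain ⟨z, hz⟩ := h
      exact ⟨z, fun z' hz' => eq_of_forall_factorial_approx hz' hz⟩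
    · exact ⟨0, fun z' hz' => (h ⟨z', hz'⟩).elim⟩
  choose lim hlim using hlim
  obtain ⟨c, hc⟩ := exists_colouring_not_isRep hind hγ (fun i => i.2.x_ne)
    (fun i => lim fun k => coePadic 5 Λ (i.1 k).u) (fun i => lim fun k => coePadic 5 Λ (i.1 k).v)
  refine ⟨⟨Y, γ, c, g, d, hY, hg0, hg, ?_⟩⟩
  intro i ζ υ hζ hυ
  rw [hlim _ ζ hζ, hlim _ υ hυ]
  exact hc i

variable [AddCommGroup K] {J : Λ ≃ List (Move Λ K) × ℕ × Λ}

/-- The integral part of the relation between consecutive quotients of a branch element. -/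
noncomputable def BranchSystem.step (S : BranchSystem J) (i : {η // IsBranch J η}) (k : ℕ) :
    K × (Λ →₀ ℤ) :=
  (i.1 k).pay + (0, marker J i.1 k + ((S.c i : ℤ) * S.d k) • (i.1 0).x)

/-- A group generated by `K`, a free group and the quotients of the coloured branch elements. -/
structure BranchGroup (S : BranchSystem J) (G : Type*) [AddCommGroup G] where
  /-- The embedding of the base. -/
  ι : K × (Λ →₀ ℤ) →+ G
  /-- The projection modulo `K`. -/
  π : G →+ (Λ → ℤ_[5])
  /-- The quotients of the branch elements. -/
  y : {η // IsBranch J η} → ℕ → G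
  ι_injective : Function.Injective ι
  π_ι : ∀ b, π (ι b) = coePadic 5 Λ b.2
  π_y : ∀ i k, π (y i k) = S.Y i k + ((S.c i : ℤ_[5]) * S.g k) • coePadic 5 Λ (i.1 0).x
  y_eq : ∀ i k, y i k = (k + 1) • y i (k + 1) + ι (S.step i k)
  exists_eq : ∀ w, ∃ n b m, w = ι b + Finsupp.linearCombination ℤ (fun i => y i n) m

theorem exists_divisible_hull (K : Type u) [AddCommGroup K] :
    ∃ (D : Type u) (_ : AddCommGroup D) (j : K →+ D), Function.Injective j ∧
      ∀ n : ℕ, n ≠ 0 → ∀ x : D, ∃ z, n • z = x := by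
  refine ⟨CharacterModule K → AddCircle (1 : ℚ), inferInstance,
    { toFun := fun k χ => χ k, map_zero' := by ext; simp, map_add' := by intros; ext; simp }, ?_, ?_⟩
  · rw [injective_iff_map_eq_zero]
    intro k hk
    by_contra hne
    obtain ⟨χ, hχ⟩ := CharacterModule.exists_character_apply_ne_zero_of_ne_zero hne
    exact hχ (congrFun hk χ)
  · intro n hn x
    have h : ∀ t : AddCircle (1 : ℚ), ∃ z, n • z = t := by
      intro t
      obtain ⟨q, rfl⟩ := QuotientAddGroup.mk_surjective t
      refine ⟨((q / n : ℚ) : AddCircle (1 : ℚ)), ?_⟩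
      rw [← AddCircle.coe_nsmul, nsmul_eq_mul, mul_div_cancel₀ _ (by exact_mod_cast hn)]
    choose f hf using h
    exact ⟨fun χ => f (x χ), funext fun χ => hf (x χ)⟩

theorem exists_branchGroup {Λ K : Type u} [AddCommGroup K]
    {J : Λ ≃ List (Move Λ K) × ℕ × Λ} (S : BranchSystem J) :
    ∃ (G : Type u) (_ : AddCommGroup G), Nonempty (BranchGroup S G) := by
  classical
  obtain ⟨D, _, j, hj, hdiv⟩ := exists_divisible_hull K
  let ι : K × (Λ →₀ ℤ) →+ D × (Λ → ℤ_[5]) := j.prodMap (coePadic 5 Λ).toAddMonoidHom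
  have hδ : ∀ i : {η // IsBranch J η}, ∃ δ : ℕ → D,
      ∀ k, δ k = (k + 1) • δ (k + 1) + j (S.step i k).1 := by
    intro i
    have h : ∀ (k : ℕ) (x : D), ∃ z, (k + 1) • z = x - j (S.step i k).1 :=
      fun k x => hdiv (k + 1) k.succ_ne_zero _
    choose nx hnx using h
    let δ : ℕ → D := fun k => Nat.rec 0 nx k
    exact ⟨δ, fun k => by rw [show δ (k + 1) = nx k (δ k) from rfl, hnx]; abel⟩
  choose δ hδ using hδ
  let y : {η // IsBranch J η} → ℕ → D × (Λ → ℤ_[5]) := fun i k =>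
    (δ i k, S.Y i k + ((S.c i : ℤ_[5]) * S.g k) • coePadic 5 Λ (i.1 0).x)
  have hy : ∀ i k, y i k = (k + 1) • y i (k + 1) + ι (S.step i k) := by
    intro i k
    refine Prod.ext (hδ i k) ?_
    show S.Y i k + ((S.c i : ℤ_[5]) * S.g k) • coePadic 5 Λ (i.1 0).x =
      (k + 1) • (S.Y i (k + 1) + ((S.c i : ℤ_[5]) * S.g (k + 1)) • coePadic 5 Λ (i.1 0).x) +
      coePadic 5 Λ (S.step i k).2
    rw [S.Y_eq i k, S.g_eq k]
    ext l
    simp only [BranchSystem.step, Pi.add_apply, Pi.smul_apply, coePadic_apply, Finsupp.add_apply,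
      Prod.snd_add, Finsupp.smul_apply]
    simp only [smul_eq_mul, nsmul_eq_mul]
    push_cast
    ring
  let lev : ℕ → AddSubgroup (D × (Λ → ℤ_[5])) := fun n =>
    (ι.coprod (Finsupp.linearCombination ℤ fun i => y i n).toAddMonoidHom).range
  have hι : ∀ n b, ι b ∈ lev n := fun n b => ⟨(b, 0), by simp⟩
  have hyl : ∀ i n, y i n ∈ lev n := fun i n => ⟨(0, Finsupp.single i 1), by simp⟩
  have hstep : ∀ n, lev n ≤ lev (n + 1) := by
    rintro n _ ⟨⟨b, m⟩, rfl⟩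
    rw [AddMonoidHom.coprod_apply]
    refine add_mem (hι _ _) ?_
    show Finsupp.linearCombination ℤ (fun i => y i n) m ∈ _
    rw [Finsupp.linearCombination_apply]
    refine sum_mem fun i _ => zsmul_mem ?_ _
    rw [hy i n]
    exact add_mem (nsmul_mem (hyl i (n + 1)) _) (hι _ _)
  have hmono : Monotone lev := monotone_nat_of_le_succ hstep
  let G : AddSubgroup (D × (Λ → ℤ_[5])) := ⨆ n, lev n
  have hG : ∀ {w}, w ∈ G ↔ ∃ n, w ∈ lev n :=
    AddSubgroup.mem_iSup_of_directed hmono.directed_le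
  let yG : {η // IsBranch J η} → ℕ → G := fun i n => ⟨y i n, hG.2 ⟨n, hyl i n⟩⟩
  refine ⟨G, inferInstance, ⟨{
    ι := ι.codRestrict G fun b => hG.2 ⟨0, hι 0 b⟩
    π := (AddMonoidHom.snd _ _).comp G.subtype
    y := yG
    ι_injective := ?_
    π_ι := fun b => rfl
    π_y := fun i k => rfl
    y_eq := fun i k => Subtype.ext (hy i k)
    exists_eq := ?_ }⟩⟩
  · intro a b hab
    have h : ι a = ι b := congrArg Subtype.val hab
    have h1 : j a.1 = j b.1 := congrArg Prod.fst h
    have h2 : coePadic 5 Λ a.2 = coePadic 5 Λ b.2 := congrArg Prod.snd h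
    refine Prod.ext (hj h1) (Finsupp.ext fun l => ?_)
    have := congrFun h2 l
    rw [coePadic_apply, coePadic_apply] at this
    exact_mod_cast this
  · rintro ⟨w, hw⟩
    obtain ⟨n, ⟨b, m⟩, rfl⟩ := hG.1 hw
    refine ⟨n, b, m, Subtype.ext ?_⟩
    have : ((Finsupp.linearCombination ℤ (fun i => yG i n) m : G) : D × (Λ → ℤ_[5])) =
        Finsupp.linearCombination ℤ (fun i => y i n) m := by
      simp [Finsupp.linearCombination_apply, Finsupp.sum, yG]
    rw [AddSubgroup.coe_add, this]
    rfl

end Systems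

section BranchGroups

variable {Λ K : Type*} [AddCommGroup K] {J : Λ ≃ List (Move Λ K) × ℕ × Λ} {S : BranchSystem J}
  {G : Type*} [AddCommGroup G]

namespace BranchGroup

variable (A : BranchGroup S G)
include A

theorem exists_isRep_of_eq {w : G} {n : ℕ} {b : K × (Λ →₀ ℤ)} {m : {η // IsBranch J η} →₀ ℤ}
    (hw : w = A.ι b + Finsupp.linearCombination ℤ (fun i => A.y i n) m) :
    ∃ b', IsRep (fun j => S.Y j 0) (fun j => (j.1 0).x) S.γ S.c (A.π w) (n.factorial : ℤ) b' m := by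
  have h : ∀ i, ∃ β : Λ →₀ ℤ, n.factorial • A.π (A.y i n) =
      (S.Y i 0 + ((S.c i : ℤ_[5]) * S.γ) • coePadic 5 Λ (i.1 0).x) - coePadic 5 Λ β := by
    intro i
    refine ⟨∑ j ∈ Finset.range n, j.factorial • (S.step i j).2, ?_⟩
    have h1 := congrArg A.π (eq_sum_factorial_add (A.y_eq i) n)
    rw [A.π_y, S.g_zero, map_add, map_sum, map_nsmul] at h1
    simp only [map_nsmul, A.π_ι] at h1
    rw [h1, map_sum]
    simp only [map_nsmul]
    abel
  choose β hβ using h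
  refine ⟨n.factorial • b.2 - Finsupp.linearCombination ℤ β m,
    by exact_mod_cast n.factorial_ne_zero, ?_⟩
  rw [hw, map_add, A.π_ι, natCast_zsmul, nsmul_add, map_sub, map_nsmul]
  have h2 : n.factorial • A.π (Finsupp.linearCombination ℤ (fun i => A.y i n) m) =
      colouredComb (fun j => S.Y j 0) (fun j => (j.1 0).x) S.γ S.c m -
        coePadic 5 Λ (Finsupp.linearCombination ℤ β m) := by
    simp only [colouredComb, Finsupp.linearCombination_apply, Finsupp.sum, map_sum, map_zsmul,
      Finset.smul_sum]
    rw [← Finset.sum_sub_distrib]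
    refine Finset.sum_congr rfl fun i _ => ?_
    rw [smul_comm, hβ i, smul_sub]
  rw [h2]
  abel

theorem exists_isRep (w : G) : ∃ M b m,
    IsRep (fun j => S.Y j 0) (fun j => (j.1 0).x) S.γ S.c (A.π w) M b m := by
  obtain ⟨n, b, m, hw⟩ := A.exists_eq w
  obtain ⟨b', hb'⟩ := A.exists_isRep_of_eq hw
  exact ⟨_, b', m, hb'⟩

theorem exists_eq_ι_of_zsmul_π {w : G} {M : ℤ} (hM : M ≠ 0) {b : Λ →₀ ℤ}
    (h : M • A.π w = coePadic 5 Λ b) : ∃ b', w = A.ι b' := by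
  obtain ⟨n, b', m, hw⟩ := A.exists_eq w
  obtain ⟨b'', hr⟩ := A.exists_isRep_of_eq hw
  have hr' : IsRep (fun j => S.Y j 0) (fun j => (j.1 0).x) S.γ S.c (A.π w) M b 0 :=
    ⟨hM, by rw [h, map_zero, add_zero]⟩
  have hm : m = 0 := by
    ext j
    have := hr.coeff_eq (linearIndependent_branches S.Y S.Y_eq) hr' j
    simpa [hM] using this
  exact ⟨b', by rw [hw, hm, map_zero, add_zero]⟩

theorem exists_eq_ι_of_π_eq_zero {w : G} (h : A.π w = 0) : ∃ κ, w = A.ι (κ, 0) := by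
  obtain ⟨⟨κ, b⟩, rfl⟩ := A.exists_eq_ι_of_zsmul_π (w := w) (M := 1) one_ne_zero (b := 0) (by simp [h])
  rw [A.π_ι] at h
  refine ⟨κ, ?_⟩
  congr
  ext l
  have := congrFun h l
  simpa using this

theorem exists_eq_ι_add_nsmul (w : G) {n : ℕ} (hn : n ≠ 0) : ∃ b w', w = A.ι b + n • w' := by
  let P : AddSubgroup G := A.ι.range ⊔ (nsmulAddMonoidHom (α := G) n).range
  have hι : ∀ b, A.ι b ∈ P := fun b => AddSubgroup.mem_sup_left ⟨b, rfl⟩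
  have hn' : ∀ w', n • w' ∈ P := fun w' => AddSubgroup.mem_sup_right ⟨w', rfl⟩
  have hy : ∀ i j k, A.y i (k + j) ∈ P → A.y i k ∈ P := by
    intro i j
    induction j with
    | zero => exact fun k h => h
    | succ j ih =>
      intro k h
      refine ih k ?_
      rw [A.y_eq]
      exact add_mem (nsmul_mem h _) (hι _)
  have hyP : ∀ i k, A.y i k ∈ P := by
    intro i k
    have hk : k + 1 ≤ n * (k + 1) := Nat.le_mul_of_pos_left _ (Nat.pos_of_ne_zero hn)
    refine hy i (n * (k + 1) - 1 - k) k ?_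
    rw [A.y_eq, show k + (n * (k + 1) - 1 - k) + 1 = n * (k + 1) by omega, mul_smul]
    exact add_mem (hn' _) (hι _)
  obtain ⟨m, b, c, hw⟩ := A.exists_eq w
  have hwP : w ∈ P := by
    rw [hw, Finsupp.linearCombination_apply]
    exact add_mem (hι _) (sum_mem fun i _ => zsmul_mem (hyP i m) _)
  obtain ⟨_, ⟨b, rfl⟩, _, ⟨w', rfl⟩, h⟩ := AddSubgroup.mem_sup.1 hwP
  exact ⟨b, w', h.symm⟩

theorem π_eq_zero_of_nsmul {w : G} {n : ℕ} (hn : n ≠ 0) (h : n • w = 0) : A.π w = 0 := by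
  have h1 : n • A.π w = 0 := by rw [← map_nsmul, h, map_zero]
  ext l
  have h2 := congrFun h1 l
  rw [Pi.smul_apply, nsmul_eq_mul, Pi.zero_apply, mul_eq_zero] at h2
  exact h2.resolve_left (by exact_mod_cast hn)

theorem torsionSub_equiv (hK : ∀ x : K, ∃ k : ℕ, 0 < k ∧ k • x = 0) :
    Nonempty (torsionSub G ≃+ K) := by
  let f : K →+ torsionSub G := (A.ι.comp (AddMonoidHom.inl K (Λ →₀ ℤ))).codRestrict _ fun κ => by
    obtain ⟨k, hk, h⟩ := hK κ
    refine ⟨k, hk, ?_⟩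
    rw [← map_nsmul, h, map_zero]
  refine ⟨(AddEquiv.ofBijective f ⟨?_, ?_⟩).symm⟩
  · intro a b hab
    exact congrArg Prod.fst (A.ι_injective (congrArg Subtype.val hab))
  · rintro ⟨w, k, hk, hw⟩
    obtain ⟨κ, hκ⟩ := A.exists_eq_ι_of_π_eq_zero (A.π_eq_zero_of_nsmul hk.ne' hw)
    exact ⟨κ, Subtype.ext hκ.symm⟩

end BranchGroup

theorem mk_prod_le_of_le {lam : Cardinal.{u}} (h : ℵ₀ ≤ lam) {α β : Type u} (hα : #α ≤ lam)
    (hβ : #β ≤ lam) : #(α × β) ≤ lam := by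
  rw [mk_prod, lift_id, lift_id]
  exact mul_le_of_le h hα hβ

theorem mk_nat_prod_le {lam : Cardinal.{u}} (h : ℵ₀ ≤ lam) {β : Type u}
    (hβ : #β ≤ lam) : #(ℕ × β) ≤ lam := by
  rw [mk_prod]
  simpa using mul_le_of_le h h hβ

theorem mk_finsupp_int_le {lam : Cardinal.{u}} (h : ℵ₀ ≤ lam) {α : Type u} (hα : #α ≤ lam) :
    #(α →₀ ℤ) ≤ lam := by
  classical
  rcases isEmpty_or_nonempty α with hα0 | hα0
  · exact (le_one_iff_subsingleton.2 inferInstance).trans (one_le_aleph0.trans h)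
  · rw [mk_finsupp_lift_of_infinite']
    simp [hα, h]

theorem mk_move_le {Λ K : Type u} (h : ℵ₀ ≤ #Λ) (hK : #K ≤ #Λ) : #(Move Λ K) ≤ #Λ := by
  have hF := mk_finsupp_int_le h (le_refl #Λ)
  refine (mk_le_of_injective (f := fun m : Move Λ K => (m.lev, m.a, m.b, m.pay, m.u, m.v, m.x))
    ?_).trans (mk_nat_prod_le h (mk_prod_le_of_le h le_rfl (mk_prod_le_of_le h le_rfl
      (mk_prod_le_of_le h (mk_prod_le_of_le h hK hF) (mk_prod_le_of_le h hF
        (mk_prod_le_of_le h hF hF))))))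
  intro m m' hm
  simp only [Prod.mk.injEq] at hm
  obtain ⟨h1, h2, h3, h4, h5, h6, h7⟩ := hm
  exact Move.ext h2 h3 h1 h4 h5 h6 h7

theorem nonempty_coding {Λ K : Type u} (h : ℵ₀ ≤ #Λ) (hK : #K ≤ #Λ) :
    Nonempty (Λ ≃ List (Move Λ K) × ℕ × Λ) := by
  refine Cardinal.eq.1 (le_antisymm ?_ ?_)
  · exact mk_le_of_injective (f := fun l => ([], 0, l)) fun a b hab => by simpa using hab
  · refine mk_prod_le_of_le h ((mk_list_le_max _).trans (max_le h (mk_move_le h hK)))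
      (mk_nat_prod_le h le_rfl)

theorem BranchGroup.mk_eq {Λ K G : Type u} [AddCommGroup K] [AddCommGroup G]
    {J : Λ ≃ List (Move Λ K) × ℕ × Λ} {S : BranchSystem J} (A : BranchGroup S G)
    (h : #Λ ^ ℵ₀ = #Λ) (h' : ℵ₀ ≤ #Λ) (hK : #K ≤ #Λ) : #G = #Λ := by
  have hI : #{η // IsBranch J η} ≤ #Λ := by
    refine (mk_subtype_le _).trans ?_
    rw [mk_arrow]
    simpa [h] using power_le_power_right (c := ℵ₀) (mk_move_le h' hK)
  apply le_antisymm
  · have hsurj : Function.Surjective fun q : ℕ × (K × (Λ →₀ ℤ)) × ({η // IsBranch J η} →₀ ℤ) =>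
        A.ι q.2.1 + Finsupp.linearCombination ℤ (fun i => A.y i q.1) q.2.2 := by
      intro w
      obtain ⟨n, b, m, hw⟩ := A.exists_eq w
      exact ⟨(n, b, m), hw.symm⟩
    exact (mk_le_of_surjective hsurj).trans (mk_nat_prod_le h' (mk_prod_le_of_le h'
      (mk_prod_le_of_le h' hK (mk_finsupp_int_le h' le_rfl)) (mk_finsupp_int_le h' hI)))
  · refine mk_le_of_injective (f := fun l => A.ι (0, Finsupp.single l 1)) fun a b hab => ?_
    have := congrArg Prod.snd (A.ι_injective hab)
    exact Finsupp.single_left_injective one_ne_zero this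

end BranchGroups

section Endomorphisms

variable {Λ K : Type*} [AddCommGroup K] {J : Λ ≃ List (Move Λ K) × ℕ × Λ} {S : BranchSystem J}
  {G : Type*} [AddCommGroup G]

omit [AddCommGroup K] in
theorem marker_congr {η θ : ℕ → Move Λ K} {k : ℕ} (h : ∀ j ≤ k, η j = θ j) :
    marker J η k = marker J θ k := by
  have h1 : initialMoves η k = initialMoves θ k :=
    List.map_inj_left.2 fun j hj => h j (List.mem_range.1 hj).le
  simp only [marker, node, h1, h k le_rfl]

theorem BranchGroup.exists_zsmul_π_eq (A : BranchGroup S G) [Nontrivial Λ]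
    (hK : ∀ x : K, ∃ k : ℕ, 0 < k ∧ k • x = 0) (f : G →+ G) {x : Λ →₀ ℤ} (hx : x ≠ 0) :
    ∃ M q : ℤ, M ≠ 0 ∧ M • A.π (f (A.ι (0, x))) = q • coePadic 5 Λ x := by
  obtain ⟨a, b, hab⟩ := exists_pair_ne Λ
  have happrox : ∀ (w : G) (k : ℕ), ∃ u : Λ →₀ ℤ, ∃ w', A.π w = coePadic 5 Λ u +
      k.factorial • w' := by
    intro w k
    obtain ⟨b, w', rfl⟩ := A.exists_eq_ι_add_nsmul w k.factorial_ne_zero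
    exact ⟨b.2, A.π w', by rw [map_add, A.π_ι, map_nsmul]⟩
  let msum : (ℕ → Move Λ K) → ℕ → Λ →₀ ℤ := fun η k =>
    ∑ j ∈ Finset.range k, j.factorial • marker J η j
  have : Nonempty (Move Λ K) := ⟨⟨a, b, 0, 0, 0, 0, 0⟩⟩
  obtain ⟨η, hη⟩ := exists_seq_of_local (A := Move Λ K)
    (fun k η => (η k).a = a ∧ (η k).b = b ∧ (η k).lev = k ∧ (η k).pay = 0 ∧ (η k).x = x ∧
      (∃ w', A.π (f (A.ι (0, x))) = coePadic 5 Λ (η k).v + k.factorial • w') ∧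
      (∃ w', A.π (f (A.ι (0, msum η k))) = coePadic 5 Λ (η k).u + k.factorial • w'))
    (by
      intro k η η' h ⟨h1, h2, h3, h4, h5, h6, h7⟩
      have hm : msum η k = msum η' k := Finset.sum_congr rfl fun j hj => by
        rw [marker_congr fun m hm => h m (hm.trans (Finset.mem_range.1 hj).le)]
      rw [h k le_rfl] at h1 h2 h3 h4 h5 h6 h7
      rw [hm] at h7
      exact ⟨h1, h2, h3, h4, h5, h6, h7⟩)
    (by
      intro k η
      obtain ⟨v, hv⟩ := happrox (f (A.ι (0, x))) k
      obtain ⟨u, hu⟩ := happrox (f (A.ι (0, msum η k))) k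
      refine ⟨⟨a, b, k, 0, u, v, x⟩, ?_⟩
      have hm : msum (Function.update η k ⟨a, b, k, 0, u, v, x⟩) k = msum η k :=
        Finset.sum_congr rfl fun j hj => by
          rw [marker_congr fun m hm => Function.update_of_ne
            (hm.trans_lt (Finset.mem_range.1 hj)).ne _ _]
      rw [hm]
      simp only [Function.update_self]
      exact ⟨trivial, trivial, trivial, trivial, trivial, hv, hu⟩)
  have hbr : IsBranch J η := by
    refine ⟨fun k => ?_, fun k m hkm => ?_, fun k l hl => ?_, ?_⟩
    · rw [(hη k).1, (hη k).2.1]; exact hab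
    · simp only [(hη _).2.2.1]; exact hkm
    · simp [(hη k).2.2.2.1] at hl
    · rw [(hη 0).2.2.2.2.1]; exact hx
  let i : {η // IsBranch J η} := ⟨η, hbr⟩
  have hxi : ∀ k, (i.1 k).x = x := fun k => (hη k).2.2.2.2.1
  have hkill : ∀ κ : K, A.π (f (A.ι (κ, 0))) = 0 := by
    intro κ
    obtain ⟨k, hk, h⟩ := hK κ
    refine A.π_eq_zero_of_nsmul hk.ne' ?_
    rw [← map_nsmul, ← map_nsmul, Prod.smul_mk, h, smul_zero, Prod.mk_zero_zero, map_zero, map_zero]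
  set υ := A.π (f (A.ι (0, x))) with hυ
  set ζ := A.π (f (A.y i 0)) - ((S.c i : ℤ_[5]) * S.γ) • υ with hζ
  obtain ⟨M, b', n, hr⟩ := A.exists_isRep (f (A.y i 0))
  obtain ⟨M', b'', n', hr'⟩ := A.exists_isRep (f (A.ι (0, x)))
  have hmain := S.eq_smul_of_isRep i ζ υ ?_ ?_ M b' n M' b'' n' (by rwa [hζ, sub_add_cancel]) hr'
  · rwa [hxi] at hmain
  · intro k
    obtain ⟨w', hw'⟩ := (hη k).2.2.2.2.2.2
    have h1 := congrArg (fun w => A.π (f w)) (eq_sum_factorial_add (A.y_eq i) k)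
    have hstep : ∑ j ∈ Finset.range k, j.factorial • A.ι (S.step i j) =
        A.ι (0, msum η k) +
          (∑ j ∈ Finset.range k, (j.factorial : ℤ) * ((S.c i : ℤ) * S.d j)) • A.ι (0, x) := by
      simp only [← map_nsmul, ← map_zsmul, ← map_sum, ← map_add]
      congr 1
      refine Prod.ext ?_ ?_
      · simp only [Prod.fst_sum, BranchSystem.step, i, (hη _).2.2.2.1]
        simp
      · simp only [Prod.snd_sum, BranchSystem.step, hxi, Prod.snd_add, Prod.smul_snd]
        simp only [i, (hη _).2.2.2.1, Prod.snd_zero, zero_add, msum, smul_add,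
          Finset.sum_add_distrib, Finset.sum_smul, mul_smul, natCast_zsmul]
    have hγ : S.γ = ∑ j ∈ Finset.range k, (j.factorial : ℤ_[5]) * S.d j +
        (k.factorial : ℤ_[5]) * S.g k := by
      have := eq_sum_factorial_add (y := S.g) (s := fun k => (S.d k : ℤ_[5]))
        (fun k => by rw [nsmul_eq_mul]; exact S.g_eq k) k
      rw [S.g_zero] at this
      simpa only [nsmul_eq_mul] using this
    simp only [hstep, map_add, map_nsmul, map_zsmul] at h1
    rw [← hυ, hw'] at h1
    refine ⟨w' + A.π (f (A.y i k)) - ((S.c i : ℤ_[5]) * S.g k) • υ, ?_⟩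
    rw [hζ, h1]
    nth_rewrite 1 [hγ]
    ext l
    simp only [Pi.add_apply, Pi.sub_apply, Pi.smul_apply]
    simp only [smul_eq_mul, nsmul_eq_mul, zsmul_eq_mul]
    push_cast
    have h2 : ∑ j ∈ Finset.range k, (j.factorial : ℤ_[5]) * ((S.c i : ℤ_[5]) * S.d j) =
        S.c i * ∑ j ∈ Finset.range k, (j.factorial : ℤ_[5]) * S.d j := by
      rw [Finset.mul_sum]
      exact Finset.sum_congr rfl fun j _ => by ring
    rw [h2]
    ring
  · intro k
    exact (hη k).2.2.2.2.2.1

theorem BranchGroup.exists_π_eq_zsmul (A : BranchGroup S G) [Nontrivial Λ]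
    (hK : ∀ x : K, ∃ k : ℕ, 0 < k ∧ k • x = 0) (f : G →+ G) :
    ∃ q : ℤ, ∀ w, A.π (f w) = q • A.π w := by
  classical
  have hcoe : Function.Injective (coePadic 5 Λ) := by
    intro b b' h
    ext l
    have := congrFun h l
    simpa using this
  have hval : ∀ l, ∃ q : ℤ, A.π (f (A.ι (0, Finsupp.single l 1))) =
      q • coePadic 5 Λ (Finsupp.single l 1) := by
    intro l
    obtain ⟨M, q, hM, h⟩ := A.exists_zsmul_π_eq hK f
      (Finsupp.single_ne_zero.2 one_ne_zero : Finsupp.single l (1 : ℤ) ≠ 0)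
    rw [← map_zsmul (coePadic 5 Λ)] at h
    obtain ⟨b, hb⟩ := A.exists_eq_ι_of_zsmul_π hM h
    rw [hb, A.π_ι, ← map_zsmul] at h
    have h1 := hcoe h
    refine ⟨b.2 l, ?_⟩
    rw [hb, A.π_ι, ← map_zsmul]
    congr 1
    ext m
    have h2 := DFunLike.congr_fun h1 m
    by_cases hm : m = l
    · subst hm; simp
    · simpa [Finsupp.single_apply, Ne.symm hm, hM] using h2
  choose q hq using hval
  have hqeq : ∀ l m, q l = q m := by
    intro l m
    by_cases hlm : l = m
    · rw [hlm]
    have hx : Finsupp.single l (1 : ℤ) + Finsupp.single m 1 ≠ 0 := by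
      intro h
      have := DFunLike.congr_fun h l
      simp [Ne.symm hlm] at this
    obtain ⟨M, r, hM, h⟩ := A.exists_zsmul_π_eq hK f hx
    have h0 : ((0, Finsupp.single l 1 + Finsupp.single m 1) : K × (Λ →₀ ℤ)) =
        (0, Finsupp.single l 1) + (0, Finsupp.single m 1) := by simp
    rw [h0, map_add, map_add, map_add, hq, hq, ← map_zsmul, ← map_zsmul, ← map_add, ← map_zsmul,
      ← map_zsmul] at h
    have h1 := hcoe h
    have hl := DFunLike.congr_fun h1 l
    have hm := DFunLike.congr_fun h1 m
    simp [Ne.symm hlm] at hl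
    simp [hlm] at hm
    exact mul_left_cancel₀ hM (hl.trans hm.symm)
  let l₀ : Λ := Classical.arbitrary Λ
  have hbase : ∀ b : K × (Λ →₀ ℤ), A.π (f (A.ι b)) = q l₀ • A.π (A.ι b) := by
    have hF : (A.π.comp (f.comp (A.ι.comp (AddMonoidHom.inr K (Λ →₀ ℤ))))) =
        q l₀ • (A.π.comp (A.ι.comp (AddMonoidHom.inr K (Λ →₀ ℤ)))) := by
      refine Finsupp.addHom_ext' fun l => AddMonoidHom.ext_int ?_
      show A.π (f (A.ι (0, Finsupp.single l 1))) = q l₀ • A.π (A.ι (0, Finsupp.single l 1))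
      rw [A.π_ι, hq, hqeq l l₀]
    rintro ⟨κ, b⟩
    have h0 : ((κ, b) : K × (Λ →₀ ℤ)) = (κ, 0) + (0, b) := by simp
    obtain ⟨k, hk, hκ⟩ := hK κ
    have h1 : k • ((κ, 0) : K × (Λ →₀ ℤ)) = 0 := by
      rw [Prod.smul_mk, hκ, smul_zero, Prod.mk_zero_zero]
    have h2 : A.π (f (A.ι (κ, 0))) = 0 := A.π_eq_zero_of_nsmul hk.ne' (by
      rw [← map_nsmul, ← map_nsmul, h1, map_zero, map_zero])
    have h3 : A.π (A.ι (κ, 0)) = 0 := by rw [A.π_ι, map_zero]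
    have h4 : A.π (f (A.ι (0, b))) = q l₀ • A.π (A.ι (0, b)) := DFunLike.congr_fun hF b
    rw [h0, map_add, map_add, map_add, map_add, h2, h3, h4, zero_add, zero_add]
  refine ⟨q l₀, fun w => ?_⟩
  ext l
  rw [← sub_eq_zero]
  refine PadicInt.eq_zero_of_forall_factorial_dvd fun n => ?_
  obtain ⟨b, w', rfl⟩ := A.exists_eq_ι_add_nsmul w n.factorial_ne_zero
  refine ⟨A.π (f w') l - q l₀ * A.π w' l, ?_⟩
  simp only [map_add, hbase, map_nsmul, Pi.add_apply, Pi.smul_apply]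
  simp only [nsmul_eq_mul, zsmul_eq_mul]
  ring

end Endomorphisms

section BoundedPart

/-- Diagonal construction of an unsolvable system `t k = (k + 1) t (k + 1) + e (x k)` in a
torsion group. -/
theorem exists_unsolvable {B K : Type*} [AddCommGroup B] [AddCommGroup K]
    (hK : ∀ x : K, ∃ k : ℕ, 0 < k ∧ k • x = 0) (T : AddSubgroup K) (e : B →+ K)
    (he : ∀ b, e b ∈ T)
    (hT : ∀ M : ℕ, M ≠ 0 → ∃ x, ∃ n : ℕ, n ≠ 0 ∧ ¬ ∃ t ∈ T, n • t = M • e x) :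
    ∃ x : ℕ → B, ¬ ∃ t : ℕ → K, (∀ k, t k ∈ T) ∧ ∀ k, t k = (k + 1) • t (k + 1) + e (x k) := by
  have hstep : ∀ (k M : ℕ) (s : B), ∃ (x : B) (n : ℕ), M ≠ 0 → n ≠ 0 ∧
      (k ≠ 0 → ¬ ∃ t ∈ T, n • t = k • e (s + k.factorial • M • x)) := by
    intro k M s
    by_cases hM : M = 0
    · exact ⟨0, 1, fun h => (h hM).elim⟩
    by_cases hk : k = 0
    · exact ⟨0, 1, fun _ => ⟨one_ne_zero, fun h => (h hk).elim⟩⟩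
    by_cases hs : ∀ n : ℕ, n ≠ 0 → ∃ t ∈ T, n • t = k • e s
    · obtain ⟨x, n, hn, hx⟩ := hT (k * k.factorial * M)
        (mul_ne_zero (mul_ne_zero hk k.factorial_ne_zero) hM)
      refine ⟨x, n, fun _ => ⟨hn, fun _ => ?_⟩⟩
      rintro ⟨t, ht, h⟩
      obtain ⟨t', ht', h'⟩ := hs n hn
      refine hx ⟨t - t', T.sub_mem ht ht', ?_⟩
      rw [smul_sub, h, h', map_add, map_nsmul, map_nsmul, smul_add, add_sub_cancel_left,
        mul_smul, mul_smul]
    · push Not at hs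
      obtain ⟨n, hn, hs⟩ := hs
      refine ⟨0, n, fun _ => ⟨hn, fun _ => ?_⟩⟩
      rintro ⟨t, ht, h⟩
      exact hs t ht (by simpa using h)
  choose X N hXN using hstep
  obtain ⟨st, hst0, hst⟩ : ∃ st : ℕ → ℕ × B, st 0 = (1, 0) ∧
      ∀ k, st (k + 1) = ((st k).1 * N k (st k).1 (st k).2,
        (st k).2 + k.factorial • (st k).1 • X k (st k).1 (st k).2) :=
    ⟨fun k => Nat.rec (1, 0) (fun k q =>
      (q.1 * N k q.1 q.2, q.2 + k.factorial • q.1 • X k q.1 q.2)) k, rfl, fun _ => rfl⟩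
  have hne : ∀ k, (st k).1 ≠ 0 := by
    intro k
    induction k with
    | zero => rw [hst0]; exact one_ne_zero
    | succ k ih =>
      rw [hst]
      exact mul_ne_zero ih (hXN _ _ _ ih).1
  have hdvd : ∀ {k m}, k ≤ m → (st k).1 ∣ (st m).1 := by
    intro k m hkm
    induction m, hkm using Nat.le_induction with
    | base => exact dvd_rfl
    | succ m _ ih =>
      rw [hst]
      exact ih.trans (dvd_mul_right _ _)
  let x : ℕ → B := fun k => (st k).1 • X k (st k).1 (st k).2
  have hsum : ∀ k, (st k).2 = ∑ j ∈ Finset.range k, j.factorial • x j := by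
    intro k
    induction k with
    | zero => rw [hst0, Finset.sum_range_zero]
    | succ k ih => rw [hst, Finset.sum_range_succ, ← ih]
  refine ⟨x, ?_⟩
  rintro ⟨t, htT, ht⟩
  obtain ⟨k, hk, hk0⟩ := hK (t 0)
  have hbad := (hXN k (st k).1 (st k).2 (hne k)).2 hk.ne'
  set m := (st (k + 1)).1 with hm
  have hm0 : m ≠ 0 := hne (k + 1)
  let D : AddSubgroup K := T.map (nsmulAddMonoidHom m)
  have hmem : ∀ {n : ℕ} {z : K}, m ∣ n → z ∈ T → n • z ∈ D := by
    rintro n z ⟨q, rfl⟩ hz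
    exact ⟨q • z, T.nsmul_mem hz q, by simp [mul_smul]⟩
  have htail : e (st (k + 1)).2 - t 0 ∈ D := by
    have h1 := eq_sum_factorial_add ht (k + 1 + m)
    rw [Finset.sum_range_add] at h1
    have h2 : e (st (k + 1)).2 = ∑ j ∈ Finset.range (k + 1), j.factorial • e (x j) := by
      rw [hsum, map_sum]
      simp only [map_nsmul]
    rw [h1, ← h2, ← neg_sub, AddSubgroup.neg_mem_iff]
    have h3 : ∀ a b c : K, a + b + c - a = b + c := fun a b c => by abel
    rw [h3]
    refine D.add_mem (D.sum_mem fun j _ => ?_) (hmem ?_ (htT _))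
    · simp only [x, map_nsmul]
      rw [smul_smul]
      have hj : m ∣ (st (k + 1 + j)).1 := hdvd (Nat.le_add_right _ _)
      exact hmem (hj.mul_left _) (he _)
    · exact (Nat.dvd_factorial (Nat.pos_of_ne_zero hm0) (by omega))
  have hfin : k • e (st (k + 1)).2 ∈ D := by
    have := D.nsmul_mem htail k
    rwa [smul_sub, hk0, sub_zero] at this
  obtain ⟨z, hz, hzeq⟩ := hfin
  refine hbad ⟨(st k).1 • z, T.nsmul_mem hz _, ?_⟩
  have h1 : m = (st k).1 * N k (st k).1 (st k).2 := by rw [hm, hst]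
  have h2 : (st (k + 1)).2 = (st k).2 + k.factorial • (st k).1 • X k (st k).1 (st k).2 := by
    rw [hst]
  rw [smul_smul, mul_comm, ← h1, ← h2]
  exact hzeq

variable {Λ K G : Type u} [AddCommGroup K] {J : Λ ≃ List (Move Λ K) × ℕ × Λ} {S : BranchSystem J}
  [AddCommGroup G]

theorem BranchGroup.exists_not_nsmul (A : BranchGroup S G) (hKred : Reduced K) (h : G →+ K)
    (hh : ¬ ∃ n : ℕ, 1 ≤ n ∧ ∀ w, n • h w = 0) {M : ℕ} (hM : M ≠ 0) :
    ∃ x, ∃ n : ℕ, n ≠ 0 ∧ ¬ ∃ t ∈ h.range, n • t = M • h.comp A.ι x := by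
  by_contra hcon
  push Not at hcon
  refine hh ⟨M, Nat.one_le_iff_ne_zero.2 hM, ?_⟩
  have hdiv : DivisibleSubgroup (h.range.map (nsmulAddMonoidHom M)) := by
    rintro n hn _ ⟨_, ⟨w, rfl⟩, rfl⟩
    obtain ⟨b, w', rfl⟩ := A.exists_eq_ι_add_nsmul w hn.ne'
    obtain ⟨_, ⟨w'', rfl⟩, h1⟩ := hcon b (n * M) (mul_ne_zero hn.ne' hM)
    refine ⟨_, ⟨h (w'' + w'), ⟨_, rfl⟩, rfl⟩, ?_⟩
    rw [AddMonoidHom.comp_apply] at h1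
    show n • M • h (w'' + w') = M • h (A.ι b + n • w')
    rw [map_add, map_add, smul_add, smul_add, smul_add, ← h1, map_nsmul, mul_smul, smul_comm M n]
  intro w
  have h1 : M • h w ∈ h.range.map (nsmulAddMonoidHom M) := ⟨h w, ⟨w, rfl⟩, rfl⟩
  rw [hKred _ hdiv] at h1
  exact h1

theorem BranchGroup.exists_nsmul_eq_zero (A : BranchGroup S G) (hKred : Reduced K)
    (hKtor : ∀ x : K, ∃ k : ℕ, 0 < k ∧ k • x = 0) (hcard : #K < #Λ) (h : G →+ K) :
    ∃ n : ℕ, 1 ≤ n ∧ ∀ w, n • h w = 0 := by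
  classical
  by_contra hh
  obtain ⟨x, hx⟩ := exists_unsolvable hKtor h.range (h.comp A.ι) (fun b => ⟨_, rfl⟩)
    fun M hM => A.exists_not_nsmul hKred h hh hM
  have hpigeon : ∀ f : Λ → K, ∃ a b, a ≠ b ∧ f a = f b := by
    intro f
    by_contra hcon
    push Not at hcon
    exact absurd (mk_le_of_injective (f := f) fun a b hab => by_contra fun hne => hcon a b hne hab)
      (not_le.2 hcard)
  let φ : (Λ →₀ ℤ) →+ K := h.comp (A.ι.comp (AddMonoidHom.inr K (Λ →₀ ℤ)))
  obtain ⟨l, l', hl, hll⟩ := hpigeon fun l => φ (Finsupp.single l 1)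
  let x₀ : Λ →₀ ℤ := Finsupp.single l 1 - Finsupp.single l' 1
  have hx₀ : x₀ ≠ 0 := by
    intro h0
    have := DFunLike.congr_fun h0 l
    simp [x₀, Ne.symm hl] at this
  have hφx₀ : φ x₀ = 0 := by rw [map_sub, sub_eq_zero]; exact hll
  let L : ℕ → ℕ := fun k => ∑ j ∈ Finset.range (k + 1), (1 + (x j).2.support.sup (nodeRank J))
  have hL : StrictMono L := strictMono_nat_of_lt_succ fun k => by
    simp only [L]
    rw [Finset.sum_range_succ _ (k + 1)]
    omega
  have hLr : ∀ k, ∀ m ∈ (x k).2.support, nodeRank J m < L k := by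
    intro k m hm
    have h1 : nodeRank J m ≤ (x k).2.support.sup (nodeRank J) := Finset.le_sup hm
    simp only [L]
    rw [Finset.sum_range_succ]
    omega
  have : Nonempty (Move Λ K) := ⟨⟨l, l, 0, 0, 0, 0, 0⟩⟩
  obtain ⟨η, hη⟩ := exists_seq_of_local (A := Move Λ K)
    (fun k η => (η k).a ≠ (η k).b ∧ (η k).lev = L k ∧ (η k).pay = x k ∧ (η k).x = x₀ ∧
      φ (marker J η k) = 0)
    (by
      intro k η η' h' ⟨h1, h2, h3, h4, h5⟩
      rw [marker_congr h'] at h5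
      rw [h' k le_rfl] at h1 h2 h3 h4
      exact ⟨h1, h2, h3, h4, h5⟩)
    (by
      intro k η
      obtain ⟨a, b, hab, hφ⟩ := hpigeon fun a =>
        φ (Finsupp.single (J.symm (initialMoves η k, L k, a)) 1)
      refine ⟨⟨a, b, L k, x k, 0, 0, x₀⟩, ?_⟩
      have hi : initialMoves (Function.update η k ⟨a, b, L k, x k, 0, 0, x₀⟩) k =
          initialMoves η k := List.map_inj_left.2 fun j hj =>
        Function.update_of_ne (List.mem_range.1 hj).ne _ _
      simp only [marker, node, hi, Function.update_self, map_sub]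
      exact ⟨hab, trivial, trivial, trivial, sub_eq_zero.2 hφ⟩)
  have hbr : IsBranch J η := by
    refine ⟨fun k => (hη k).1, fun k m hkm => ?_, fun k m hm => ?_, ?_⟩
    · simp only [(hη _).2.1]; exact hL hkm
    · rw [(hη k).2.2.1] at hm
      rw [(hη k).2.1]
      exact hLr k m hm
    · rw [(hη 0).2.2.2.1]; exact hx₀
  let i : {η // IsBranch J η} := ⟨η, hbr⟩
  refine hx ⟨fun k => h (A.y i k), fun k => ⟨_, rfl⟩, fun k => ?_⟩
  have hstep : h (A.ι (S.step i k)) = h (A.ι (x k)) := by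
    have h1 : S.step i k = x k + (0, marker J η k + ((S.c i : ℤ) * S.d k) • x₀) := by
      simp only [BranchSystem.step, i, (hη _).2.2.1, (hη _).2.2.2.1]
    have h2 : φ (marker J η k + ((S.c i : ℤ) * S.d k) • x₀) = 0 := by
      rw [map_add, map_zsmul, hφx₀, (hη k).2.2.2.2, smul_zero, add_zero]
    rw [h1, map_add, map_add]
    exact (congrArg _ h2).trans (add_zero _)
  show h (A.y i k) = _
  rw [A.y_eq i k, map_add, map_nsmul, hstep]
  rfl

theorem BranchGroup.boundedlyEndoRigid (A : BranchGroup S G) [Nontrivial Λ] (hKred : Reduced K)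
    (hKtor : ∀ x : K, ∃ k : ℕ, 0 < k ∧ k • x = 0) (hcard : #K < #Λ) :
    BoundedlyEndoRigid G := by
  intro f
  obtain ⟨q, hq⟩ := A.exists_π_eq_zsmul hKtor f
  have hκ : ∀ w, ∃ κ, f w - q • w = A.ι (κ, 0) := fun w =>
    A.exists_eq_ι_of_π_eq_zero (by rw [map_sub, hq, map_zsmul, sub_self])
  choose κ hκ using hκ
  have hinj : ∀ {a b : K}, A.ι (a, 0) = A.ι (b, 0) → a = b := fun h =>
    congrArg Prod.fst (A.ι_injective h)
  let h : G →+ K := AddMonoidHom.mk' κ fun w w' => hinj (by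
    have : ((κ w + κ w', 0) : K × (Λ →₀ ℤ)) = (κ w, 0) + (κ w', 0) := by simp
    rw [this, map_add, ← hκ, ← hκ, ← hκ, map_add, smul_add]
    abel)
  obtain ⟨n, hn, hn0⟩ := A.exists_nsmul_eq_zero hKred hKtor hcard h
  refine ⟨q, n, hn, fun w => ?_⟩
  have h1 : n • κ w = 0 := hn0 w
  rw [hκ, ← map_nsmul, Prod.smul_mk, h1, smul_zero, Prod.mk_zero_zero, map_zero]

theorem BranchGroup.eq_of_bounded (A : BranchGroup S G) [Nonempty Λ] {f : G →+ G} {m m' : ℤ}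
    {n n' : ℕ} (hn : 1 ≤ n) (hn' : 1 ≤ n') (h : ∀ x, n • (f x - m • x) = 0)
    (h' : ∀ x, n' • (f x - m' • x) = 0) : m = m' := by
  let l : Λ := Classical.arbitrary Λ
  set w := A.ι (0, Finsupp.single l 1) with hw
  have h1 : A.π (f w) = m • A.π w := by
    have := A.π_eq_zero_of_nsmul (by omega) (h w)
    rwa [map_sub, map_zsmul, sub_eq_zero] at this
  have h2 : A.π (f w) = m' • A.π w := by
    have := A.π_eq_zero_of_nsmul (by omega) (h' w)
    rwa [map_sub, map_zsmul, sub_eq_zero] at this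
  have h3 := congrFun (h1.symm.trans h2) l
  rw [hw, A.π_ι] at h3
  simpa using h3

end BoundedPart

/-- for λ = λ^ℵ₀ > 2^ℵ₀ and a reduced torsion abelian group K of size < λ
which is nontrivial (some Γ_p(K) infinite, or Γ_p(K) ≠ 0 for infinitely many primes p),
there is a boundedly endo-rigid abelian group G of size λ with tor(G) ≅ K, and moreover
End(G)/BEnd(G) ≅ ℤ, i.e. for every endomorphism f there is a *unique* m ∈ ℤ such that
f - m•id has bounded range. -/
theorem stmt0 (lam : Cardinal.{u}) (hlam1 : lam ^ Cardinal.aleph0 = lam)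
    (hlam2 : 2 ^ Cardinal.aleph0 < lam)
    (K : Type u) [AddCommGroup K] (hKred : Reduced K)
    (hKtor : ∀ x : K, ∃ k : ℕ, 0 < k ∧ k • x = 0)
    (hKcard : #K < lam)
    (hnontriv : (∃ p : ℕ, p.Prime ∧ Infinite (Gamma K p)) ∨
      {p : ℕ | p.Prime ∧ Gamma K p ≠ ⊥}.Infinite) :
    ∃ (G : Type u) (_ : AddCommGroup G),
      Nonempty ((torsionSub G) ≃+ K) ∧
      #G = lam ∧
      BoundedlyEndoRigid G ∧
      (∀ f : G →+ G, ∃! m : ℤ, ∃ n : ℕ, 1 ≤ n ∧ ∀ x : G, n • (f x - m • x) = 0) := by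
  have hlam0 : ℵ₀ ≤ lam := (cantor ℵ₀).le.trans hlam2.le
  obtain ⟨Λ, rfl⟩ : ∃ Λ : Type u, #Λ = lam := ⟨lam.out, mk_out lam⟩
  have : Infinite Λ := infinite_iff.2 hlam0
  obtain ⟨J⟩ := nonempty_coding hlam0 hKcard.le
  obtain ⟨S⟩ := nonempty_branchSystem J
  obtain ⟨G, _, ⟨A⟩⟩ := exists_branchGroup S
  have hrigid := A.boundedlyEndoRigid hKred hKtor hKcard
  refine ⟨G, inferInstance, A.torsionSub_equiv hKtor, A.mk_eq hlam1 hlam0 hKcard.le, hrigid,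
    fun f => ?_⟩
  obtain ⟨m, n, hn, h⟩ := hrigid f
  refine ⟨m, ⟨n, hn, h⟩, ?_⟩
  rintro m' ⟨n', hn', h'⟩
  exact A.eq_of_bounded hn' hn h' h
end

section
/- Let λ be a cardinal with λ = λ^ℵ₀ > 2^ℵ₀ and let S be a nonempty set of cardinality at most λ. Then there exists a family ⟨g_η : η ∈ Λ_ω[λ]⟩, where each g_η assigns a value g_η(0) ∈ S and values g_η(n+1) ∈ S × S for n < ω, such that for every function g : Λ_{<ω}[λ] → S, every ordinal γ < λ, and every function f : Λ_{<ω}[λ] → γ, there is η ∈ Λ_ω[λ] satisfying: (a) η(0,1) > γ; (b) g_η(0) = g(⟨⟩); (c) g_η(n+1) = (g(η↾_L n), g(η↾_R n)) for all n < ω; and (d) for all n with 1 ≤ n < ω, η(n,1) < η(n,2) and f(η↾_L n) = f(η↾_R n). (This is the existence of a twofold λ-black box.) -/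
open Cardinal

/-- Membership in `Λ_ω[α]`: sequences `η : ω → α × α` with
`η(n,1) ≤ η(n,2) < η(n+1,1) < α`. -/
def IsLambdaOmega (α : Ordinal) (η : ℕ → Ordinal × Ordinal) : Prop :=
  (∀ n, (η n).1 ≤ (η n).2) ∧ (∀ n, (η n).2 < (η (n + 1)).1) ∧ (∀ n, (η n).2 < α)

/-- Membership in `Λ_{<ω}[α]`: either the empty sequence (`none`), or a finite list of
pairs of ordinals `< α` followed by a last ordinal `< α`, where the pairs are
componentwise increasing as required, and the two components of the `ℓ`-th pair are
equal iff `ℓ = 0`. -/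
def IsLambdaFin (α : Ordinal) : Option (List (Ordinal × Ordinal) × Ordinal) → Prop
  | none => True
  | some (l, last) =>
      last < α ∧
      (∀ p ∈ l, p.1 ≤ p.2 ∧ p.2 < α) ∧
      (∀ i : ℕ, ∀ hi : i + 1 < l.length, (l[i]'(by omega)).2 < (l[i + 1]'hi).1) ∧
      (∀ i : ℕ, ∀ hi : i < l.length, ((l[i]'hi).1 = (l[i]'hi).2 ↔ i = 0))

/-- The set `Λ_ω[α]`. -/
def LambdaOmega (α : Ordinal) : Type _ := {η : ℕ → Ordinal × Ordinal // IsLambdaOmega α η}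

/-- The set `Λ_{<ω}[α]`. -/
def LambdaFin (α : Ordinal) : Type _ :=
  {x : Option (List (Ordinal × Ordinal) × Ordinal) // IsLambdaFin α x}

/-- `η ↾_L n`: the first `n` pairs of `η` followed by `η(n, 1)`. -/
def restrictL (η : ℕ → Ordinal × Ordinal) (n : ℕ) : Option (List (Ordinal × Ordinal) × Ordinal) :=
  some (List.ofFn (fun i : Fin n => η i), (η n).1)

/-- `η ↾_R n`: the first `n` pairs of `η` followed by `η(n, 2)`. -/
def restrictR (η : ℕ → Ordinal × Ordinal) (n : ℕ) : Option (List (Ordinal × Ordinal) × Ordinal) :=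
  some (List.ofFn (fun i : Fin n => η i), (η n).2)

universe u

/-- A function from `κ` many points into the ordinals below some `θ < κ.ord` is not injective. -/
theorem exists_ne_map_eq_of_lt_ord {κ : Cardinal.{u}} {ι : Type u} (hι : #ι = κ) {θ : Ordinal.{u}}
    (hθ : θ < κ.ord) (k : ι → Ordinal.{u}) (hk : ∀ i, k i < θ) : ∃ i j, i ≠ j ∧ k i = k j := by
  by_contra! h
  have hinj : Function.Injective fun i => Ordinal.ToType.mk ⟨k i, hk i⟩ := fun i j hij => by
    by_contra hne
    exact h i j hne (Subtype.ext_iff.1 (Ordinal.ToType.mk.injective hij))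
  have hle := mk_le_of_injective hinj
  rw [hι, mk_toType] at hle
  exact absurd (lt_ord.1 hθ) hle.not_gt

/-- The ordinals below `κ.ord` can be coloured by at most `κ` colours so that every function on
them with values bounded below `κ.ord` takes the same value at two large points of any prescribed
colour. -/
theorem exists_colouring_pair {κ : Cardinal.{u}} (hκ : ℵ₀ ≤ κ) (C : Type u) [Nonempty C]
    (hC : #C ≤ κ) :
    ∃ d : Ordinal.{u} → C, ∀ (c : C) (δ γ : Ordinal.{u}), δ < κ.ord → γ < κ.ord →
      ∀ h : Ordinal.{u} → Ordinal.{u}, (∀ α, h α < γ) →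
        ∃ α β, δ < α ∧ α < β ∧ β < κ.ord ∧ d α = c ∧ h α = h β := by
  have hcard : #(κ.ord.ToType) = #(κ.ord.ToType × C) := by
    rw [← mul_def, mk_ord_toType, mul_eq_left hκ hC (mk_ne_zero C)]
  obtain ⟨e⟩ := Cardinal.eq.1 hcard
  classical
  refine ⟨fun α => if hα : α < κ.ord then (e (Ordinal.ToType.mk ⟨α, hα⟩)).2
    else Classical.arbitrary C, fun c δ γ hδ hγ h hh => ?_⟩
  let a : κ.ord.ToType → Ordinal := fun i => (Ordinal.ToType.mk.symm (e.symm (i, c))).1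
  have ha : ∀ i, a i < κ.ord := fun i => (Ordinal.ToType.mk.symm (e.symm (i, c))).2
  have hinj : Function.Injective a := fun i j hij => by
    simpa using Ordinal.ToType.mk.symm.injective (Subtype.ext hij)
  have hsucc : Order.succ δ < κ.ord := (isSuccLimit_ord hκ).succ_lt hδ
  obtain ⟨i, j, hne, hij⟩ := exists_ne_map_eq_of_lt_ord (mk_ord_toType κ)
    (Ordinal.isPrincipal_add_ord hκ hsucc hγ)
    (fun i => if a i ≤ δ then a i else Order.succ δ + h (a i)) (fun i => by
      dsimp only
      split_ifs with hi
      · exact (Order.lt_succ_iff.2 hi).trans_le le_self_add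
      · gcongr; exact hh _)
  have hsmall : ∀ x y, x ≤ δ → x ≠ Order.succ δ + y := fun x y hx hxy =>
    (Order.lt_succ_iff.2 hx).not_ge (hxy ▸ le_self_add)
  have key : δ < a i ∧ δ < a j ∧ h (a i) = h (a j) := by
    split_ifs at hij with hi hj hj
    · exact absurd (hinj hij) hne
    · exact absurd hij (hsmall _ _ hi)
    · exact absurd hij.symm (hsmall _ _ hj)
    · exact ⟨not_le.1 hi, not_le.1 hj, add_left_cancel hij⟩
  have hd : ∀ i, (if hα : a i < κ.ord then (e (Ordinal.ToType.mk ⟨a i, hα⟩)).2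
      else Classical.arbitrary C) = c := fun i => by
    rw [dif_pos (ha i)]
    change (e (Ordinal.ToType.mk (Ordinal.ToType.mk.symm (e.symm (i, c))))).2 = c
    simp
  rcases lt_or_gt_of_ne (hinj.ne hne) with hlt | hlt
  · exact ⟨a i, a j, key.1, hlt, ha j, hd i, key.2.2⟩
  · exact ⟨a j, a i, key.2.1, hlt, ha i, hd j, key.2.2.symm⟩

/-- The two restrictions of a sequence in `Λ_ω[α]` belong to `Λ_{<ω}[α]` when exactly the first of
its pairs is constant. -/
theorem IsLambdaOmega.isLambdaFin_ofFn {α : Ordinal} {η : ℕ → Ordinal × Ordinal}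
    (hη : IsLambdaOmega α η) (h0 : ∀ n, (η n).1 = (η n).2 ↔ n = 0) (n : ℕ) {β : Ordinal}
    (hβ : β < α) : IsLambdaFin α (some (List.ofFn (fun i : Fin n => η i), β)) := by
  refine ⟨hβ, fun p hp => ?_, fun i hi => ?_, fun i hi => ?_⟩
  · obtain ⟨i, rfl⟩ := (List.mem_ofFn' _ _).1 hp
    exact ⟨hη.1 i, hη.2.2 i⟩
  · simpa using hη.2.1 i
  · simpa using h0 i

/-- A sequence can be built by choosing each term from the list of its predecessors. -/
theorem exists_seq_of_list {A : Type*} (x : A) (next : List A → A → A) :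
    ∃ η : ℕ → A, η 0 = x ∧ ∀ n, η (n + 1) = next (List.ofFn fun i : Fin n => η i) (η n) := by
  let st : ℕ → List A × A := fun n =>
    Nat.rec ([], x) (fun _ s => (s.1 ++ [s.2], next s.1 s.2)) n
  have hst : ∀ n, (st n).1 = List.ofFn fun i : Fin n => (st i).2 := fun n => by
    induction n with
    | zero => simp [st]
    | succ n ih =>
      rw [List.ofFn_succ_last]
      change (st n).1 ++ [(st n).2] = _
      rw [ih]
      simp
  exact ⟨fun n => (st n).2, rfl, fun n => by rw [← hst n]⟩

/-- existence of a twofold λ-black box, for λ = λ^ℵ₀ > 2^ℵ₀ and a nonempty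
set S with #S ≤ λ.  Here `g0 η` plays the role of `g_η(0) ∈ S` and `gs η n` the role of
`g_η(n+1) ∈ S × S`. -/
theorem stmt1 (lam : Cardinal.{u}) (hlam1 : lam ^ Cardinal.aleph0 = lam)
    (hlam2 : 2 ^ Cardinal.aleph0 < lam)
    (S : Type u) [Nonempty S] (hS : #S ≤ lam) :
    ∃ (g0 : LambdaOmega lam.ord → S) (gs : LambdaOmega lam.ord → ℕ → S × S),
      ∀ (g : LambdaFin lam.ord → S) (γ : Ordinal), γ < lam.ord →
        ∀ f : LambdaFin lam.ord → Ordinal, (∀ x, f x < γ) →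
          ∃ η : LambdaOmega lam.ord,
            γ < (η.1 0).1 ∧
            g0 η = g ⟨none, trivial⟩ ∧
            (∀ n : ℕ, ∃ (hL : IsLambdaFin lam.ord (restrictL η.1 n))
                (hR : IsLambdaFin lam.ord (restrictR η.1 n)),
                gs η n = (g ⟨restrictL η.1 n, hL⟩, g ⟨restrictR η.1 n, hR⟩)) ∧
            (∀ n : ℕ, 1 ≤ n → (η.1 n).1 < (η.1 n).2 ∧
              ∀ (hL : IsLambdaFin lam.ord (restrictL η.1 n))
                (hR : IsLambdaFin lam.ord (restrictR η.1 n)),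
                f ⟨restrictL η.1 n, hL⟩ = f ⟨restrictR η.1 n, hR⟩) := by
  classical
  have hω : ℵ₀ ≤ lam := ((cantor ℵ₀).trans hlam2).le
  have hC : #(S × S) ≤ lam := by
    rw [← mul_def]
    exact (mul_le_mul' hS hS).trans (mul_eq_self hω).le
  obtain ⟨d, hd⟩ := exists_colouring_pair hω (S × S) hC
  refine ⟨fun η => (d (η.1 0).1).1, fun η n => d (η.1 (n + 1)).1, fun g γ hγ f hf => ?_⟩
  let g' : Option (List (Ordinal × Ordinal) × Ordinal) → S := fun x =>
    if hx : IsLambdaFin lam.ord x then g ⟨x, hx⟩ else Classical.arbitrary S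
  let f' : Option (List (Ordinal × Ordinal) × Ordinal) → Ordinal := fun x =>
    if hx : IsLambdaFin lam.ord x then f ⟨x, hx⟩ else 0
  have hf' : ∀ x, f' x < γ := fun x => by
    dsimp only [f']
    split_ifs with hx
    · exact hf _
    · exact zero_le.trans_lt (hf ⟨none, trivial⟩)
  have hpair : ∀ (l : List (Ordinal × Ordinal)) (δ : Ordinal) (c : S × S), ∃ p : Ordinal × Ordinal,
      δ < lam.ord → δ < p.1 ∧ p.1 < p.2 ∧ p.2 < lam.ord ∧ d p.1 = c ∧
        f' (some (l, p.1)) = f' (some (l, p.2)) := fun l δ c => by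
    by_cases hδ : δ < lam.ord
    · obtain ⟨α, β, h⟩ := hd c δ γ hδ hγ (fun α => f' (some (l, α))) fun α => hf' _
      exact ⟨(α, β), fun _ => h⟩
    · exact ⟨0, fun h => absurd h hδ⟩
  choose pick hpick using hpair
  obtain ⟨α, β, hγα, hαβ, hβ, hdα, -⟩ := hd (g ⟨none, trivial⟩, g ⟨none, trivial⟩) γ γ hγ hγ
    (fun α => f' (some ([], α))) fun α => hf' _
  obtain ⟨η, hη0, hηs⟩ := exists_seq_of_list (α, α) fun l p =>
    pick (l ++ [p]) p.2 (g' (some (l, p.1)), g' (some (l, p.2)))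
  have hlt : ∀ n, (η n).2 < lam.ord := fun n => by
    induction n with
    | zero => rw [hη0]; exact hαβ.trans hβ
    | succ n ih => rw [hηs]; exact (hpick _ _ _ ih).2.2.1
  have hstep := fun n => hpick ((List.ofFn fun i : Fin n => η i) ++ [η n]) _
    (g' (some (List.ofFn fun i : Fin n => η i, (η n).1)),
      g' (some (List.ofFn fun i : Fin n => η i, (η n).2))) (hlt n)
  simp only [← hηs] at hstep
  have hstrict : ∀ n, 1 ≤ n → (η n).1 < (η n).2 := fun n hn => by
    obtain ⟨m, rfl⟩ := Nat.exists_eq_add_of_le' hn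
    exact (hstep m).2.1
  have h0 : ∀ n, (η n).1 = (η n).2 ↔ n = 0 := fun n => by
    rcases Nat.eq_zero_or_pos n with rfl | hn
    · simp [hη0]
    · simp [(hstrict n hn).ne, hn.ne']
  have hle : ∀ n, (η n).1 ≤ (η n).2 := fun n => by
    rcases Nat.eq_zero_or_pos n with rfl | hn
    · simp [hη0]
    · exact (hstrict n hn).le
  have hη : IsLambdaOmega lam.ord η := ⟨hle, fun n => (hstep n).1, hlt⟩
  have hL : ∀ n, IsLambdaFin lam.ord (restrictL η n) := fun n =>
    hη.isLambdaFin_ofFn h0 n ((hle n).trans_lt (hlt n))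
  have hR : ∀ n, IsLambdaFin lam.ord (restrictR η n) := fun n =>
    hη.isLambdaFin_ofFn h0 n (hlt n)
  refine ⟨⟨η, hη⟩, ?_, ?_, fun n => ⟨hL n, hR n, ?_⟩, fun n hn => ⟨hstrict n hn, fun _ _ => ?_⟩⟩
  · simpa [hη0] using hγα
  · simp [hη0, hdα]
  · have hg : (g' (restrictL η n), g' (restrictR η n)) =
        (g ⟨restrictL η n, hL n⟩, g ⟨restrictR η n, hR n⟩) := by
      simp only [g', dif_pos (hL n), dif_pos (hR n)]
    exact (hstep n).2.2.2.1.trans hg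
  · obtain ⟨m, rfl⟩ := Nat.exists_eq_add_of_le' hn
    have hf_eq : f' (restrictL η (m + 1)) = f' (restrictR η (m + 1)) := by
      have h := (hstep m).2.2.2.2
      simp only [restrictL, restrictR, List.ofFn_succ_last]
      simpa using h
    simpa only [f', dif_pos (hL (m + 1)), dif_pos (hR (m + 1))] using hf_eq
end

section
/- Let α be an ordinal. Then every countable subset Λ of Λ_ω[α] is free; that is, there exists a function h : Λ → ω such that the family of sets ⟨{η↾_L n : h(η) ≤ n < ω} ∪ {η↾_R n : h(η) ≤ n < ω} : η ∈ Λ⟩ is pairwise disjoint. -/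
open Cardinal

/-- If a restriction of `η` at `n` equals a restriction of `ν` at `m`, then `n = m` and the two
sequences agree below `n`. -/
theorem eq_of_lt_of_restrict_eq {η ν : ℕ → Ordinal × Ordinal} {n m : ℕ}
    {x : Option (List (Ordinal × Ordinal) × Ordinal)}
    (hη : x = restrictL η n ∨ x = restrictR η n) (hν : x = restrictL ν m ∨ x = restrictR ν m) :
    n = m ∧ ∀ k < n, η k = ν k := by
  have hl : List.ofFn (fun i : Fin n => η i) = List.ofFn (fun i : Fin m => ν i) := by
    rcases hη with rfl | rfl <;> rcases hν with h | h <;>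
      simp only [restrictL, restrictR, Option.some.injEq, Prod.mk.injEq] at h <;> exact h.1
  obtain rfl : n = m := by simpa using congrArg List.length hl
  exact ⟨rfl, fun k hk => congrFun (List.ofFn_injective hl) ⟨k, hk⟩⟩

/-- An `ℕ`-valued function `d` of pairs from a countable type is dominated by a function `h` of one
variable: for any two distinct points `a` and `b`, either `d a b ≤ h a` or `d b a ≤ h b`. -/
theorem exists_forall_ne_le_or_le {ι : Type*} [Countable ι] (d : ι → ι → ℕ) :
    ∃ h : ι → ℕ, ∀ a b, a ≠ b → d a b ≤ h a ∨ d b a ≤ h b := by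
  obtain ⟨e, he⟩ := exists_injective_nat ι
  have hfin (a : ι) : {b | e b < e a}.Finite := (Set.finite_Iio (e a)).preimage he.injOn
  refine ⟨fun a => (hfin a).toFinset.sup (d a), fun a b hab => ?_⟩
  rcases (he.ne hab).lt_or_gt with hlt | hlt
  · exact .inr (Finset.le_sup (f := d b) (by simpa using hlt))
  · exact .inl (Finset.le_sup (f := d a) (by simpa using hlt))

/-- every countable subset Λ of Λ_ω[α] is free: there is h : Λ → ω such
that the sets {η↾_L n, η↾_R n : h(η) ≤ n < ω}, for η ∈ Λ, are pairwise disjoint. -/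
theorem stmt2 (α : Ordinal) (Λ : Set (LambdaOmega α)) (hΛ : Λ.Countable) :
    ∃ h : Λ → ℕ,
      ∀ η ν : Λ, η ≠ ν →
        Disjoint
          {x : Option (List (Ordinal × Ordinal) × Ordinal) |
            ∃ n, h η ≤ n ∧ (x = restrictL (η : LambdaOmega α).1 n ∨
              x = restrictR (η : LambdaOmega α).1 n)}
          {x : Option (List (Ordinal × Ordinal) × Ordinal) |
            ∃ n, h ν ≤ n ∧ (x = restrictL (ν : LambdaOmega α).1 n ∨
              x = restrictR (ν : LambdaOmega α).1 n)} := by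
  have : Countable Λ := hΛ.to_subtype
  have hex (η ν : Λ) : ∃ k, η ≠ ν → η.1.1 k ≠ ν.1.1 k := by
    by_contra! hall
    exact (hall 0).1 (Subtype.ext (Subtype.ext (funext fun k => (hall k).2)))
  choose d hd using hex
  obtain ⟨h, hh⟩ := exists_forall_ne_le_or_le fun η ν => d η ν + 1
  refine ⟨h, fun η ν hne => Set.disjoint_left.2 ?_⟩
  rintro x ⟨n, hn, hxη⟩ ⟨m, hm, hxν⟩
  obtain ⟨rfl, hagree⟩ := eq_of_lt_of_restrict_eq hxη hxν
  rcases hh η ν hne with hle | hle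
  · exact hd η ν hne (hagree _ (by lia))
  · exact hd ν η hne.symm (hagree _ (by lia)).symm
end

section
/- Let G be an abelian group whose torsion subgroup T is unbounded and reduced, and such that the quotient group G/T is reduced. Then there exists a sequence ⟨a_n : n < ω⟩ of elements of T such that there is no sequence ⟨c_n : n < ω⟩ of elements of G satisfying c_n = a_n + n!·c_{n+1} for all n < ω. -/
open Cardinal

/-- In a reduced group, the equations `d n = n! • d (n + 1)` have only the zero solution. -/
lemma Reduced.eq_zero_of_eq_factorial_smul {B : Type*} [AddCommGroup B] (hB : Reduced B)
    (d : ℕ → B) (hd : ∀ n, d n = Nat.factorial n • d (n + 1)) (n : ℕ) : d n = 0 := by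
  have hdiv : DivisibleSubgroup (AddSubgroup.closure (Set.range d)) := by
    intro k hk x hx
    induction hx using AddSubgroup.closure_induction with
    | mem x hx =>
      obtain ⟨n, rfl⟩ := hx
      have key : ∀ j, ∃ q : ℕ, d n = q • d (n + j) := by
        intro j
        induction j with
        | zero => exact ⟨1, by simp⟩
        | succ j ih =>
          obtain ⟨q, hq⟩ := ih
          exact ⟨q * Nat.factorial (n + j), by rw [hq, hd (n + j), mul_smul]; rfl⟩
      obtain ⟨q, hq⟩ := key k
      obtain ⟨r, hr⟩ : k ∣ Nat.factorial (n + k) := Nat.dvd_factorial hk (by omega)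
      refine ⟨(q * r) • d (n + k + 1),
        AddSubgroup.nsmul_mem _ (AddSubgroup.subset_closure (Set.mem_range_self _)) _, ?_⟩
      rw [hq, hd (n + k), hr, smul_smul, smul_smul]
      congr 1
      ring
    | zero => exact ⟨0, AddSubgroup.zero_mem _, smul_zero _⟩
    | add x y _ _ hx hy =>
      obtain ⟨b, hb, rfl⟩ := hx
      obtain ⟨b', hb', rfl⟩ := hy
      exact ⟨b + b', AddSubgroup.add_mem _ hb hb', smul_add _ _ _⟩
    | neg x _ hx =>
      obtain ⟨b, hb, rfl⟩ := hx
      exact ⟨-b, AddSubgroup.neg_mem _ hb, smul_neg _ _⟩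
  have hmem : d n ∈ AddSubgroup.closure (Set.range d) := AddSubgroup.subset_closure ⟨n, rfl⟩
  rwa [hB _ hdiv, AddSubgroup.mem_bot] at hmem

/-- In a reduced unbounded group, no nonzero multiple `N • A` consists of elements divisible by
every positive integer. -/
lemma Reduced.exists_smul_not_dvd {A : Type*} [AddCommGroup A] (hA : Reduced A)
    (hunb : ∀ N : ℕ, 1 ≤ N → ∃ x : A, N • x ≠ 0) (N : ℕ) (hN : 1 ≤ N) :
    ∃ (x : A) (M : ℕ), 1 ≤ M ∧ ∀ t : A, N • x ≠ M • t := by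
  by_contra! h
  obtain ⟨x, hx⟩ := hunb N hN
  have hdiv : DivisibleSubgroup (nsmulAddMonoidHom (α := A) N).range := by
    rintro k hk _ ⟨y, rfl⟩
    obtain ⟨t, ht⟩ := h y (N * k) (Nat.mul_pos hN hk)
    refine ⟨N • t, ⟨t, rfl⟩, ?_⟩
    rw [nsmulAddMonoidHom_apply, ht, smul_smul, mul_comm]
  have hmem : N • x ∈ (nsmulAddMonoidHom (α := A) N).range := ⟨x, rfl⟩
  rw [hA _ hdiv, AddSubgroup.mem_bot] at hmem
  exact hx hmem

/-- In a reduced unbounded group there is a sequence `a` such that every solution of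
`c n = a n + n! • c (n + 1)` starts with an element of infinite order. -/
lemma Reduced.exists_seq_smul_ne_zero {A : Type*} [AddCommGroup A] (hA : Reduced A)
    (hunb : ∀ N : ℕ, 1 ≤ N → ∃ x : A, N • x ≠ 0) :
    ∃ a : ℕ → A, ∀ c : ℕ → A, (∀ n, c n = a n + Nat.factorial n • c (n + 1)) →
      ∀ k : ℕ, 1 ≤ k → k • c 0 ≠ 0 := by
  let P : ℕ → ℕ := fun n => ∏ i ∈ Finset.range n, Nat.factorial i
  have hP : ∀ n, 1 ≤ P n := fun n => Finset.prod_pos fun i _ => Nat.factorial_pos i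
  have hPs : ∀ n, P (n + 1) = P n * Nat.factorial n := fun n => Finset.prod_range_succ _ n
  have step : ∀ (n : ℕ) (s : A) (D : ℕ), ∃ (x : A) (M : ℕ), 1 ≤ M ∧
      (1 ≤ n → 1 ≤ D → ∀ t : A, n • (s + P n • D • x) ≠ M • t) := by
    intro n s D
    by_cases hn : 1 ≤ n ∧ 1 ≤ D
    · by_cases hs : ∃ M : ℕ, 1 ≤ M ∧ ∀ t : A, n • s ≠ M • t
      · obtain ⟨M, hM, h⟩ := hs
        exact ⟨0, M, hM, fun _ _ t => by simpa using h t⟩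
      · push Not at hs
        obtain ⟨x, M, hM, h⟩ := hA.exists_smul_not_dvd hunb (n * (P n * D))
          (Nat.mul_pos hn.1 (Nat.mul_pos (hP n) hn.2))
        refine ⟨x, M, hM, fun _ _ t ht => ?_⟩
        obtain ⟨u, hu⟩ := hs M hM
        apply h (t - u)
        rw [smul_sub, ← ht, ← hu, smul_add, add_sub_cancel_left, mul_smul, mul_smul]
    · exact ⟨0, 1, le_rfl, fun h1 h2 => absurd ⟨h1, h2⟩ hn⟩
  choose X M hM hX using step
  let S : ℕ → A × ℕ := fun n => Nat.rec (0, 1)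
    (fun n p => (p.1 + P n • p.2 • X n p.1 p.2, p.2 * M n p.1 p.2)) n
  let m : ℕ → ℕ := fun n => M n (S n).1 (S n).2
  let a : ℕ → A := fun n => (S n).2 • X n (S n).1 (S n).2
  have hS1 : ∀ n, (S (n + 1)).1 = (S n).1 + P n • a n := fun n => rfl
  have hS2 : ∀ n, (S (n + 1)).2 = (S n).2 * m n := fun n => rfl
  have hD : ∀ n, 1 ≤ (S n).2 := by
    intro n
    induction n with
    | zero => exact le_rfl
    | succ n ih => rw [hS2]; exact Nat.mul_pos ih (hM _ _ _)
  refine ⟨a, fun c hc k hk h0 => ?_⟩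
  have hsum : ∀ n, c 0 = (S n).1 + P n • c n := by
    intro n
    induction n with
    | zero => simp [S, P]
    | succ n ih =>
      rw [ih, hS1, hPs, mul_smul, add_assoc, ← smul_add, ← hc]
  have hdvd : ∀ j, m k ∣ (S (k + 1 + j)).2 := by
    intro j
    induction j with
    | zero => rw [add_zero, hS2]; exact dvd_mul_left _ _
    | succ j ih => rw [← add_assoc, hS2]; exact ih.mul_right _
  have htail : ∀ j, ∃ t, (S (k + 1 + j)).1 = (S (k + 1)).1 + m k • t := by
    intro j
    induction j with
    | zero => exact ⟨0, by simp⟩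
    | succ j ih =>
      obtain ⟨t, ht⟩ := ih
      obtain ⟨r, hr⟩ := hdvd j
      obtain ⟨y, hy⟩ : ∃ y, a (k + 1 + j) = (S (k + 1 + j)).2 • y := ⟨_, rfl⟩
      refine ⟨t + P (k + 1 + j) • r • y, ?_⟩
      rw [← add_assoc, hS1, ht, smul_add, add_assoc, hy, hr, mul_smul,
        smul_comm (m k) (P (k + 1 + j))]
  obtain ⟨t, ht⟩ := htail (m k)
  obtain ⟨q, hq⟩ : m k ∣ P (k + 1 + m k) :=
    (Nat.dvd_factorial (n := m k) (hM _ _ _) le_rfl).trans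
      (Finset.dvd_prod_of_mem Nat.factorial (Finset.mem_range.2 (by omega)))
  apply hX k (S k).1 (S k).2 hk (hD k) (-(k • (t + q • c (k + 1 + m k))))
  change k • (S (k + 1)).1 = m k • _
  have h1 := hsum (k + 1 + m k)
  rw [ht, hq, mul_smul, add_assoc, ← smul_add] at h1
  rw [h1, smul_add, smul_comm k (m k)] at h0
  rw [smul_neg]
  exact eq_neg_of_add_eq_zero_left h0

/-- if the torsion subgroup T of G is unbounded and reduced, and G/T is
reduced, then there is a sequence ⟨a_n⟩ in T such that no sequence ⟨c_n⟩ in G satisfies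
c_n = a_n + n!•c_{n+1} for all n. -/
theorem stmt3 (G : Type*) [AddCommGroup G]
    (hTunb : ¬ IsBoundedSubgroup (torsionSub G))
    (hTred : Reduced (torsionSub G))
    (hQred : Reduced (G ⧸ torsionSub G)) :
    ∃ a : ℕ → G, (∀ n, a n ∈ torsionSub G) ∧
      ¬ ∃ c : ℕ → G, ∀ n : ℕ, c n = a n + (Nat.factorial n) • c (n + 1) := by
  obtain ⟨a, ha⟩ := hTred.exists_seq_smul_ne_zero (fun N hN => by
    by_contra! h
    exact hTunb ⟨N, hN, fun x hx => congrArg Subtype.val (h ⟨x, hx⟩)⟩)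
  refine ⟨fun n => a n, fun n => (a n).2, ?_⟩
  rintro ⟨c, hc⟩
  have hmem : ∀ n, c n ∈ torsionSub G := by
    intro n
    rw [← QuotientAddGroup.eq_zero_iff]
    refine hQred.eq_zero_of_eq_factorial_smul (fun n => (c n : G ⧸ torsionSub G)) (fun n => ?_) n
    have h : ((a n : G) : G ⧸ torsionSub G) = 0 := (QuotientAddGroup.eq_zero_iff _).2 (a n).2
    conv_lhs => rw [hc n, QuotientAddGroup.mk_add, h, zero_add, QuotientAddGroup.mk_nsmul]
  obtain ⟨k, hk, hk0⟩ := hmem 0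
  exact ha (fun n => ⟨c n, hmem n⟩) (fun n => Subtype.ext (hc n)) k hk (Subtype.ext hk0)
end

section
/- Let G be an abelian group such that NQr(G) holds. Then G is not co-Hopfian. Moreover, if m, n ≥ 1 are integers with m ∣ n and h is an endomorphism of G whose range is contained in Γ_n(G) and whose restriction to Γ_n(G) is an (m,n)-anti-witness, then the endomorphism m·id_G + h of G is injective but not surjective. -/
open Cardinal

/-- Every abelian group embeds in a group that is injective in the sense of Baer's criterion, and
so are the quotients of the latter. -/
theorem exists_injective_addMonoidHom_baer_quotient.{u} {M : Type u} [AddCommGroup M] :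
    ∃ (D : Type u) (_ : AddCommGroup D) (i : M →+ D), Function.Injective i ∧
      Module.Baer ℤ D ∧ ∀ S : AddSubgroup D, Module.Baer ℤ (D ⧸ S) := by
  let D := CharacterModule M → AddCircle (1 : ℚ)
  let i : M →+ D :=
    { toFun := fun m c => c m
      map_zero' := funext fun c => map_zero c
      map_add' := fun a b => funext fun c => map_add c a b }
  refine ⟨D, inferInstance, i, ?_, .of_divisible D, fun S => ?_⟩
  · exact (injective_iff_map_eq_zero i).2 fun m hm =>
      CharacterModule.eq_zero_of_character_apply fun c => congrFun hm c
  · let _ : DivisibleBy (D ⧸ S) ℤ :=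
      (QuotientAddGroup.mk'_surjective S).divisibleBy (QuotientAddGroup.mk' S)
        fun d k => map_zsmul (QuotientAddGroup.mk' S) k d
    exact .of_divisible (D ⧸ S)

/-- If `K` acts injectively on `G ⧸ A`, then every homomorphism from `A` to a group killed by `K`
extends to `G`. -/
theorem exists_extension_of_bounded {G M : Type*} [AddCommGroup G] [AddCommGroup M]
    (A : AddSubgroup G) (K : ℕ) (hA : ∀ g, K • g ∈ A → g ∈ A) (hM : ∀ x : M, K • x = 0)
    (f : A →+ M) : ∃ F : G →+ M, ∀ x : A, F x = f x := by
  obtain ⟨D, _, i, hi, hD, hE⟩ := exists_injective_addMonoidHom_baer_quotient (M := M)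
  obtain ⟨F, hF⟩ := hD.extension_property_addMonoidHom A.subtype A.subtype_injective (i.comp f)
  have hFA (x : A) : F x = i (f x) := DFunLike.congr_fun hF x
  let q := QuotientAddGroup.mk' A
  let π := QuotientAddGroup.mk' i.range
  let Fbar : G ⧸ A →+ D ⧸ i.range := QuotientAddGroup.lift A (π.comp F) fun x hx =>
    (QuotientAddGroup.eq_zero_iff _).2 ⟨f ⟨x, hx⟩, (hFA ⟨x, hx⟩).symm⟩
  have hK : Function.Injective (nsmulAddMonoidHom (α := G ⧸ A) K) := by
    refine (injective_iff_map_eq_zero _).2 fun t ht => ?_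
    obtain ⟨g, rfl⟩ := QuotientAddGroup.mk'_surjective A t
    exact (QuotientAddGroup.eq_zero_iff _).2 (hA g ((QuotientAddGroup.eq_zero_iff _).1 ht))
  obtain ⟨φ, hφ⟩ := (hE i.range).extension_property_addMonoidHom _ hK Fbar
  have hKφ (t : G ⧸ A) : K • φ t = Fbar t := by
    rw [← map_nsmul]
    exact DFunLike.congr_fun hφ t
  let μ : D ⧸ i.range →+ D := QuotientAddGroup.lift i.range (nsmulAddMonoidHom K) <| by
    rintro _ ⟨x, rfl⟩
    simp [← map_nsmul, hM]
  have hπμ (e : D ⧸ i.range) : π (μ e) = K • e := by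
    obtain ⟨d, rfl⟩ := QuotientAddGroup.mk'_surjective i.range e
    exact map_nsmul π K d
  let H : G →+ D := F - μ.comp (φ.comp q)
  have hH (g : G) : H g ∈ i.range := by
    refine (QuotientAddGroup.eq_zero_iff _).1 (?_ : π (F g - μ (φ (q g))) = 0)
    rw [map_sub, hπμ, hKφ]
    exact sub_self _
  let e := AddMonoidHom.ofInjective hi
  refine ⟨e.symm.toAddMonoidHom.comp (H.codRestrict i.range hH), fun x => ?_⟩
  refine e.symm_apply_eq.2 (Subtype.ext ?_)
  have hq : q (x : G) = 0 := (QuotientAddGroup.eq_zero_iff _).2 x.2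
  change F x - μ (φ (q x)) = i (f x)
  rw [hq, map_zero, map_zero, sub_zero, hFA]

theorem dvd_pow_of_dvd_of_dvd_pow {d k n j : ℕ} (hk : k ≠ 0) (hn : n ≠ 0) (hdk : d ∣ k)
    (hdn : d ∣ n ^ j) : d ∣ n ^ k := by
  have hd : d ≠ 0 := ne_zero_of_dvd_ne_zero hk hdk
  refine (Nat.factorization_le_iff_dvd hd (pow_ne_zero k hn)).1 fun p => ?_
  have h := (Nat.factorization_le_iff_dvd hd (pow_ne_zero j hn)).2 hdn p
  have hlt := (Nat.factorization_lt p hd).trans_le (Nat.le_of_dvd (Nat.pos_of_ne_zero hk) hdk)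
  simp only [Nat.factorization_pow, Finsupp.smul_apply, smul_eq_mul] at h ⊢
  rcases Nat.eq_zero_or_pos (n.factorization p) with h0 | h0
  · simpa [h0] using h
  · exact hlt.le.trans (Nat.le_mul_of_pos_right k h0)

theorem mem_Gamma_of_pow_nsmul_mem {G : Type*} [AddCommGroup G] {n : ℕ} (k : ℕ) {g : G}
    (hg : n ^ k • g ∈ Gamma G n) : g ∈ Gamma G n := by
  obtain ⟨j, hj⟩ := hg
  exact ⟨j + k, by rw [pow_add, mul_smul, hj]⟩

theorem mem_Gamma_of_nsmul_mem {G : Type*} [AddCommGroup G] {m n : ℕ} (hmn : m ∣ n) {g : G}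
    (hg : m • g ∈ Gamma G n) : g ∈ Gamma G n := by
  obtain ⟨c, rfl⟩ := hmn
  refine mem_Gamma_of_pow_nsmul_mem 1 ?_
  rw [pow_one, mul_nsmul]
  exact nsmul_mem hg c

/-- A bounded endomorphism of `Γ_n(G)` extends to an endomorphism of `G` with range in `Γ_n(G)`. -/
theorem exists_extension_of_bounded_Gamma {G : Type*} [AddCommGroup G] {n k : ℕ} (hn : n ≠ 0)
    (hk : k ≠ 0) (h : Gamma G n →+ Gamma G n) (hh : ∀ x, k • h x = 0) :
    ∃ (F : G →+ G) (hr : ∀ x, F x ∈ Gamma G n), restrictGamma n F (fun x _ => hr x) = h := by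
  have hb (x : h.range) : n ^ k • x = 0 := by
    obtain ⟨_, x, rfl⟩ := x
    obtain ⟨j, hj⟩ := (h x).2
    refine Subtype.ext (addOrderOf_dvd_iff_nsmul_eq_zero.1 ?_)
    refine dvd_pow_of_dvd_of_dvd_pow (j := j) hk hn ?_ ?_
    · exact addOrderOf_dvd_iff_nsmul_eq_zero.2 (hh x)
    · exact addOrderOf_dvd_iff_nsmul_eq_zero.2 (Subtype.ext hj)
  obtain ⟨F, hF⟩ := exists_extension_of_bounded (Gamma G n) (n ^ k)
    (fun g => mem_Gamma_of_pow_nsmul_mem k) hb h.rangeRestrict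
  refine ⟨(Gamma G n).subtype.comp (h.range.subtype.comp F), fun x => (F x).1.2, ?_⟩
  ext x
  exact congrArg (fun y : h.range => ((y : Gamma G n) : G)) (hF x)

theorem injective_and_not_surjective_of_isAntiWitness {G : Type*} [AddCommGroup G] {m n : ℕ}
    (hmn : m ∣ n) (h : G →+ G) (hr : ∀ x : G, h x ∈ Gamma G n)
    (hw : IsAntiWitness G m n (restrictGamma n h (fun x _ => hr x))) :
    Function.Injective (fun x : G => m • x + h x) ∧
      ¬ Function.Surjective (fun x : G => m • x + h x) := by
  obtain ⟨-, hinj, hsurj⟩ := hw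
  have hmem {x : G} (hx : m • x + h x ∈ Gamma G n) : x ∈ Gamma G n :=
    mem_Gamma_of_nsmul_mem hmn ((AddSubgroup.add_mem_cancel_right _ (hr x)).1 hx)
  constructor
  · refine (injective_iff_map_eq_zero (nsmulAddMonoidHom m + h)).2 fun x hx => ?_
    replace hx : m • x + h x = 0 := hx
    have hxΓ : x ∈ Gamma G n := hmem (hx ▸ zero_mem _)
    refine congrArg Subtype.val (@hinj ⟨x, hxΓ⟩ 0 (Subtype.ext ?_))
    simpa [restrictGamma] using hx
  · intro hs
    rcases hsurj with hns | ⟨-, hnd⟩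
    · refine hns fun y => ?_
      obtain ⟨x, hx : m • x + h x = y⟩ := hs y
      exact ⟨⟨x, hmem (hx ▸ y.2)⟩, Subtype.ext hx⟩
    · refine hnd fun y => ?_
      obtain ⟨g, rfl⟩ := QuotientAddGroup.mk'_surjective (Gamma G n) y
      obtain ⟨x, rfl⟩ := hs g
      refine ⟨QuotientAddGroup.mk' (Gamma G n) x, ?_⟩
      have hx : QuotientAddGroup.mk' (Gamma G n) (h x) = 0 :=
        (QuotientAddGroup.eq_zero_iff _).2 (hr x)
      rw [map_add, hx, add_zero, map_nsmul]

/-- if NQr(G) holds then G is not co-Hopfian; moreover for m ∣ n (m, n ≥ 1)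
and h an endomorphism of G with range inside Γ_n(G) whose restriction to Γ_n(G) is an
(m,n)-anti-witness, the endomorphism m•id_G + h is injective but not surjective. -/
theorem stmt4 (G : Type*) [AddCommGroup G] (hNQr : NQr G) :
    (¬ CoHopfian G) ∧
    (∀ m n : ℕ, 1 ≤ m → 1 ≤ n → m ∣ n →
      ∀ (h : G →+ G) (hr : ∀ x : G, h x ∈ Gamma G n),
        IsAntiWitness G m n (restrictGamma n h (fun x _ => hr x)) →
        Function.Injective (fun x : G => m • x + h x) ∧
        ¬ Function.Surjective (fun x : G => m • x + h x)) := by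
  refine ⟨fun hco => ?_, fun m n _ _ hmn h hr hw =>
    injective_and_not_surjective_of_isAntiWitness hmn h hr hw⟩
  obtain ⟨m, n, -, hn, hmn, h, hw⟩ := hNQr
  obtain ⟨k, hk, hkh⟩ := hw.1
  obtain ⟨F, hr, rfl⟩ :=
    exists_extension_of_bounded_Gamma (Nat.one_le_iff_ne_zero.1 hn)
      (Nat.one_le_iff_ne_zero.1 hk) h hkh
  obtain ⟨hinj, hns⟩ := injective_and_not_surjective_of_isAntiWitness hmn F hr hw
  exact hns (hco (nsmulAddMonoidHom m + F) hinj)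
end

section
/- Let p be a prime and let K be an abelian p-group (every element of K has order a power of p). If NQr(K) holds, then K is infinite. -/
open Cardinal

/-- For `m ∣ n`, multiplication by `m` is injective on `G ⧸ Γ_n(G)`. -/
theorem nsmul_injective_quotient_Gamma (G : Type*) [AddCommGroup G] {m n : ℕ} (hmn : m ∣ n) :
    Function.Injective (fun z : G ⧸ Gamma G n => m • z) := by
  refine (injective_iff_map_eq_zero (nsmulAddMonoidHom (α := G ⧸ Gamma G n) m)).2 fun z hz => ?_
  induction z using QuotientAddGroup.induction_on with
  | H x =>
    have hx : m • x ∈ Gamma G n := (QuotientAddGroup.eq_zero_iff (m • x)).1 hz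
    obtain ⟨k, hk⟩ := hx
    obtain ⟨c, hc⟩ := hmn
    refine (QuotientAddGroup.eq_zero_iff x).2 ⟨k + 1, ?_⟩
    have hn : n ^ (k + 1) = c * (n ^ k * m) := by
      rw [pow_succ]
      nth_rewrite 2 [hc]
      ring
    rw [hn, mul_smul, mul_smul, hk, smul_zero]

/-- if K is an abelian p-group and NQr(K) holds, then K is infinite. -/
theorem stmt5 (p : ℕ) (hp : p.Prime) (K : Type*) [AddCommGroup K]
    (hKp : ∀ x : K, ∃ k : ℕ, p ^ k • x = 0)
    (hNQr : NQr K) : Infinite K := by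
  by_contra hfin
  have : Finite K := not_infinite_iff_finite.1 hfin
  obtain ⟨m, n, -, -, hmn, h, -, hinj, hsurj | ⟨-, hdiv⟩⟩ := hNQr
  · exact hsurj (Finite.surjective_of_injective hinj)
  · exact hdiv (Finite.surjective_of_injective (nsmul_injective_quotient_Gamma K hmn))
end

section
/- Let G be an abelian group, let m ≥ 1 be an integer, and suppose there is a bounded endomorphism h of G such that f := m·id_G + h is injective but not surjective. Then there exists an integer n ≥ 1 with m ∣ n such that NQr_{(m,n)}(G) holds; moreover, the restriction of h to Γ_n(G) is an (m,n)-anti-witness. -/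
open Cardinal

/-- if m ≥ 1 and h is a bounded endomorphism of G such that f = m•id + h is
injective but not surjective, then there is n ≥ 1 with m ∣ n such that NQr_{(m,n)}(G)
holds; moreover h maps Γ_n(G) into itself and its restriction is an (m,n)-anti-witness. -/
theorem stmt7 (G : Type*) [AddCommGroup G] (m : ℕ) (hm : 1 ≤ m)
    (h : G →+ G) (hb : HasBoundedRange h)
    (hinj : Function.Injective (fun x : G => m • x + h x))
    (hnsur : ¬ Function.Surjective (fun x : G => m • x + h x)) :
    ∃ n : ℕ, 1 ≤ n ∧ m ∣ n ∧ NQrAt G m n ∧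
      ∃ hmem : ∀ x ∈ Gamma G n, h x ∈ Gamma G n,
        IsAntiWitness G m n (restrictGamma n h hmem) := by
  obtain ⟨k, hk, hkh⟩ := hb
  have hrange : ∀ x, h x ∈ Gamma G (k * m) := fun x =>
    ⟨1, by rw [pow_one, mul_comm, mul_smul, hkh, smul_zero]⟩
  have hanti : IsAntiWitness G m (k * m)
      (restrictGamma (k * m) h fun x _ => hrange x) := by
    refine ⟨⟨k, hk, fun x => Subtype.ext (hkh x.1)⟩, fun x y hxy =>
      Subtype.ext (hinj (congrArg Subtype.val hxy)), ?_⟩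
    by_contra hcon
    obtain ⟨hsur, hdiv⟩ := not_or.mp hcon
    rw [not_not] at hsur
    have hquot : ∀ y : G, ∃ z : G, y - m • z ∈ Gamma G (k * m) := by
      intro y
      rcases hm.eq_or_lt with rfl | hlt
      · exact ⟨y, by simp [zero_mem]⟩
      · obtain ⟨z, hz⟩ := not_not.mp (fun hn => hdiv ⟨hlt, hn⟩) (y : G ⧸ Gamma G (k * m))
        obtain ⟨z, rfl⟩ := QuotientAddGroup.mk_surjective z
        refine ⟨z, ?_⟩
        rw [← QuotientAddGroup.eq_zero_iff, QuotientAddGroup.mk_sub, QuotientAddGroup.mk_nsmul,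
          hz, sub_self]
    refine hnsur fun y => ?_
    obtain ⟨z, hz⟩ := hquot y
    obtain ⟨g, hg⟩ := hsur ⟨y - m • z - h z, sub_mem hz (hrange z)⟩
    have hg' : m • (g : G) + h g = y - m • z - h z := congrArg Subtype.val hg
    refine ⟨z + g, ?_⟩
    change m • (z + (g : G)) + h (z + g) = y
    rw [smul_add, map_add, add_add_add_comm, hg']
    abel
  exact ⟨k * m, Nat.mul_pos hk hm, dvd_mul_left m k, ⟨_, hanti⟩, _, hanti⟩
end

section
/- Let G be a reduced abelian group with #G > 2^ℵ₀. If G is co-Hopfian, then Qr_*(G) holds; that is, Qr(G) holds and there is at least one prime p such that Γ_p(G) is unbounded. -/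
open Cardinal

/-- A homomorphism killed by `k` extends along any `j : F →+ G` that reflects divisibility by
the divisors of `k`. -/
theorem exists_extension_of_reflects_dvd {F G B : Type*} [AddCommGroup F] [AddCommGroup G]
    [AddCommGroup B] (j : F →+ G) {k : ℕ} (hk0 : 0 < k)
    (hpure : ∀ d : ℕ, d ∣ k → ∀ (z : G) (x : F), d • z = j x → ∃ x', x = d • x')
    (h : F →+ B) (hk : ∀ x, k • h x = 0) : ∃ e : G →+ B, ∀ x, e (j x) = h x := by
  let P : Set (AddSubgroup G) := {C | (∀ g : G, k • g ∈ C) ∧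
    ∀ d : ℕ, d ∣ k → ∀ (z : G) (x : F), d • z - j x ∈ C → ∃ x', x = d • x'}
  have hP0 : (nsmulAddMonoidHom k : G →+ G).range ∈ P := by
    refine ⟨fun g => ⟨g, rfl⟩, ?_⟩
    rintro d ⟨c, rfl⟩ z x ⟨g, hg⟩
    refine hpure d ⟨c, rfl⟩ (z - c • g) x ?_
    have hg' : (d * c) • g = d • z - j x := hg
    rw [smul_sub, ← mul_smul, hg']
    abel
  obtain ⟨C, -, hC⟩ := zorn_le_nonempty₀ P (by
    intro c hcP hc C₀ hC₀
    refine ⟨sSup c, ⟨fun g => ?_, fun d hd z x hx => ?_⟩, fun C hC => le_sSup hC⟩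
    · exact le_sSup hC₀ ((hcP hC₀).1 g)
    · obtain ⟨C, hC, hxC⟩ := (AddSubgroup.mem_sSup_of_directedOn ⟨C₀, hC₀⟩ hc.directedOn).1 hx
      exact (hcP hC).2 d hd z x hxC) _ hP0
  obtain ⟨⟨hkC, hCd⟩, hmax⟩ := hC
  have htop : j.range ⊔ C = ⊤ := by
    set S := j.range ⊔ C with hS
    have hex : AddMonoid.ExponentExists (G ⧸ S) := by
      refine ⟨k, hk0, fun q => ?_⟩
      obtain ⟨g, rfl⟩ := QuotientAddGroup.mk_surjective q
      rw [← QuotientAddGroup.mk_nsmul, QuotientAddGroup.eq_zero_iff]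
      exact (le_sup_right : C ≤ S) (hkC g)
    obtain ⟨q, hq⟩ := AddMonoid.exists_addOrderOf_eq_exponent hex
    obtain ⟨y₀, rfl⟩ := QuotientAddGroup.mk_surjective q
    set r := AddMonoid.exponent (G ⧸ S) with hr
    have hrpos : 0 < r := hex.exponent_pos
    have hrS : ∀ g : G, r • g ∈ S := fun g => by
      rw [← QuotientAddGroup.eq_zero_iff, QuotientAddGroup.mk_nsmul]
      exact AddMonoid.exponent_nsmul_eq_zero _
    have hrk : r ∣ k := AddMonoid.exponent_dvd_of_forall_nsmul_eq_zero fun q => by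
      obtain ⟨g, rfl⟩ := QuotientAddGroup.mk_surjective q
      rw [← QuotientAddGroup.mk_nsmul, QuotientAddGroup.eq_zero_iff]
      exact (le_sup_right : C ≤ S) (hkC g)
    obtain ⟨_, ⟨x₀, rfl⟩, c₀, hc₀, hxc⟩ := AddSubgroup.mem_sup.1 (hrS y₀)
    obtain ⟨x₁, rfl⟩ := hCd r hrk y₀ x₀ (by rw [← hxc]; simpa using hc₀)
    set y := y₀ - j x₁ with hy
    have hry : r • y ∈ C := by
      rw [hy, smul_sub, ← hxc, map_nsmul]; simpa using hc₀
    have hord : ∀ a : ℤ, a • y ∈ S → (r : ℤ) ∣ a := fun a ha => by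
      rw [← hq, addOrderOf_dvd_iff_zsmul_eq_zero, ← QuotientAddGroup.mk_zsmul,
        QuotientAddGroup.eq_zero_iff]
      have : a • y₀ = a • y + a • j x₁ := by rw [hy]; simp [smul_sub]
      rw [this]
      exact add_mem ha (zsmul_mem ((le_sup_left : _ ≤ S) ⟨x₁, rfl⟩) a)
    have hPC' : C ⊔ AddSubgroup.zmultiples y ∈ P := by
      refine ⟨fun g => (le_sup_left : C ≤ _) (hkC g), fun d hd z x hx => ?_⟩
      obtain ⟨c, hc, _, ⟨a, rfl⟩, hca⟩ := AddSubgroup.mem_sup.1 hx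
      simp only at hca
      have hdpos : 0 < d := Nat.pos_of_dvd_of_pos hd hk0
      obtain ⟨r', hr'⟩ := Nat.gcd_dvd_right d r
      obtain ⟨d', hd'⟩ := Nat.gcd_dvd_left d r
      have hrd : r' * d = d' * r := by
        have : (d.gcd r) * (r' * d) = (d.gcd r) * (d' * r) := by
          rw [← mul_assoc, ← hr', ← mul_assoc, ← hd', mul_comm]
        exact Nat.eq_of_mul_eq_mul_left (Nat.gcd_pos_of_pos_left r hdpos) this
      have hr'pos : 0 < r' := by
        rcases Nat.eq_zero_or_pos r' with h0 | h0
        · simp [h0] at hr'; omega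
        · exact h0
      have ha : ((d.gcd r : ℕ) : ℤ) ∣ a := by
        have hmem : ((r' : ℤ) * a) • y ∈ S := by
          have : ((r' : ℤ) * a) • y = d' • (r • z) - r' • j x - r' • c := by
            have : a • y = d • z - j x - c := by rw [← hca]; abel
            rw [mul_smul, this, natCast_zsmul, smul_sub, smul_sub, ← mul_smul, hrd, mul_smul]
          rw [this]
          exact sub_mem (sub_mem (nsmul_mem (hrS z) _)
            (nsmul_mem ((le_sup_left : _ ≤ S) ⟨x, rfl⟩) _))
            (nsmul_mem ((le_sup_right : C ≤ S) hc) _)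
        have := hord _ hmem
        rw [hr', Nat.cast_mul, mul_comm] at this
        exact (mul_dvd_mul_iff_left (by exact_mod_cast hr'pos.ne')).1 this
      obtain ⟨a₁, rfl⟩ := ha
      refine hCd d hd (z - (a₁ * Nat.gcdA d r) • y) x ?_
      have : d • (z - (a₁ * Nat.gcdA d r) • y) - j x = c + (a₁ * Nat.gcdB d r) • (r • y) := by
        have h1 : d • z = j x + (c + ((d.gcd r : ℤ) * a₁) • y) := by rw [hca]; abel
        rw [smul_sub, h1, Nat.gcd_eq_gcd_ab]
        simp only [← natCast_zsmul]
        module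
      rw [this]
      exact add_mem hc (zsmul_mem hry _)
    have hyC : y ∈ C := hmax hPC' le_sup_left
      ((le_sup_right : _ ≤ C ⊔ AddSubgroup.zmultiples y) (AddSubgroup.mem_zmultiples y))
    have hr1 : (r : ℤ) ∣ 1 := hord 1 (by simpa using (le_sup_right : C ≤ S) hyC)
    have hr1' : r = 1 := by exact_mod_cast Int.eq_one_of_dvd_one (by positivity) hr1
    exact (AddSubgroup.eq_top_iff' _).2 fun g => by simpa [hr1'] using hrS g
  have hex : ∀ g : G, ∃ x : F, g - j x ∈ C := fun g => by
    obtain ⟨_, ⟨x, rfl⟩, c, hc, rfl⟩ := AddSubgroup.mem_sup.1 (htop ▸ AddSubgroup.mem_top g)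
    exact ⟨x, by simpa using hc⟩
  choose X hX using hex
  have key : ∀ g x, g - j x ∈ C → h (X g) = h x := fun g x hx => by
    obtain ⟨x', hx'⟩ := hCd k dvd_rfl 0 (X g - x) (by
      have := sub_mem (hX g) hx
      rw [map_sub]
      convert this using 1
      rw [smul_zero]
      abel)
    rw [← sub_eq_zero, ← map_sub, hx', map_nsmul, hk]
  refine ⟨AddMonoidHom.mk' (fun g => h (X g)) fun a b => ?_, fun x => key _ _ (by simp)⟩
  rw [← map_add]
  refine key _ _ ?_
  have := add_mem (hX a) (hX b)
  rw [map_add]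
  convert this using 1
  abel

/-- Every positive integer splits as a divisor of a power of `n` times an integer prime
to `n`. -/
theorem exists_dvd_pow_mul_coprime (n : ℕ) {d : ℕ} (hd : 0 < d) :
    ∃ a b u : ℕ, d = b * u ∧ b ∣ n ^ a ∧ u.Coprime n := by
  induction d using Nat.strong_induction_on with
  | _ d ih =>
    by_cases hg : d.gcd n = 1
    · exact ⟨0, 1, d, by simp, by simp, hg⟩
    · obtain ⟨d', hd'⟩ := Nat.gcd_dvd_left d n
      have hgpos := Nat.gcd_pos_of_pos_left n hd
      have hd'pos : 0 < d' := Nat.pos_of_ne_zero (by rintro rfl; simp at hd'; omega)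
      obtain ⟨a, b, u, rfl, hb, hu⟩ := ih d' (by
        rw [hd']; exact (Nat.lt_mul_iff_one_lt_left hd'pos).2 (by omega)) hd'pos
      refine ⟨a + 1, d.gcd n * b, u, by rw [mul_assoc]; exact hd', ?_, hu⟩
      rw [pow_succ, mul_comm]
      exact mul_dvd_mul hb (Nat.gcd_dvd_right _ _)

theorem eq_zero_of_coprime_nsmul {G : Type*} [AddCommGroup G] {a b : ℕ} (hab : a.Coprime b)
    {x : G} (ha : a • x = 0) (hb : b • x = 0) : x = 0 := by
  rw [← AddMonoid.addOrderOf_eq_one_iff, ← Nat.dvd_one, ← hab.gcd_eq_one]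
  exact Nat.dvd_gcd (addOrderOf_dvd_of_nsmul_eq_zero ha) (addOrderOf_dvd_of_nsmul_eq_zero hb)

/-- `Γ_n(G)` is pure in `G`. -/
theorem Gamma_pure {G : Type*} [AddCommGroup G] (n : ℕ) {d : ℕ} (hd : 0 < d) (z : G)
    (x : Gamma G n) (hx : d • z = (Gamma G n).subtype x) : ∃ x', x = d • x' := by
  obtain ⟨a, b, u, rfl, ⟨c, hb⟩, hu⟩ := exists_dvd_pow_mul_coprime n hd
  obtain ⟨l, hl⟩ := x.2
  rw [AddSubgroup.subtype_apply] at hx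
  have hcop : u.Coprime (n ^ (l + a)) := hu.pow_right _
  have hbez := Nat.gcd_eq_gcd_ab u (n ^ (l + a))
  rw [hcop.gcd_eq_one] at hbez
  have hz : (n ^ (l + a) * u) • z = 0 := by
    have : n ^ (l + a) * u = c * (n ^ l * (b * u)) := by rw [pow_add, hb]; ring
    rw [this, mul_smul, mul_smul (n ^ l), hx, hl, smul_zero]
  refine ⟨⟨(u * Nat.gcdA u (n ^ (l + a)) : ℤ) • z, l + a, ?_⟩, Subtype.ext ?_⟩
  · rw [smul_comm, mul_comm, mul_smul, natCast_zsmul, ← mul_smul u, mul_comm u, hz, smul_zero]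
  · rw [AddSubgroup.coe_nsmul, ← hx]
    generalize hz' : (b * u) • z = z'
    have h1 : (u * Nat.gcdA u (n ^ (l + a)) : ℤ)
        = 1 - Nat.gcdB u (n ^ (l + a)) * (n ^ (l + a) : ℕ) := by
      push_cast at hbez ⊢; linarith
    have h2 : ((n ^ (l + a) : ℕ) : ℤ) • z' = 0 := by
      rw [natCast_zsmul, ← hz', ← mul_smul, mul_left_comm, mul_smul, hz, smul_zero]
    change z' = (b * u) • (u * Nat.gcdA u (n ^ (l + a)) : ℤ) • z
    rw [smul_comm, hz', h1, sub_smul, mul_smul, h2, smul_zero, one_smul, sub_zero]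

theorem Gamma_exists_extension {G B : Type*} [AddCommGroup G] [AddCommGroup B] (n : ℕ)
    {k : ℕ} (hk0 : 0 < k) (h : Gamma G n →+ B) (hk : ∀ x, k • h x = 0) :
    ∃ e : G →+ B, ∀ x : Gamma G n, e x = h x :=
  exists_extension_of_reflects_dvd (Gamma G n).subtype hk0
    (fun _ hd => Gamma_pure n (Nat.pos_of_dvd_of_pos hd hk0)) h hk

theorem CoHopfian.qr {G : Type*} [AddCommGroup G] (hch : CoHopfian G) : Qr G := by
  rintro ⟨m, n, hm, hn, hmn, h, ⟨k, hk0, hk⟩, hinj, hsurj⟩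
  obtain ⟨e, he⟩ := Gamma_exists_extension n hk0 h hk
  let f : G →+ G := m • AddMonoidHom.id G + (Gamma G n).subtype.comp e
  have hf : ∀ g, f g = m • g + e g := fun g => rfl
  have hmem : ∀ g, f g ∈ Gamma G n → g ∈ Gamma G n := fun g hg =>
    mem_Gamma_of_nsmul_mem hmn ((AddSubgroup.add_mem_cancel_right _ (e g).2).1 (hf g ▸ hg))
  have hres : ∀ x : Gamma G n, f x = (m • x + h x : Gamma G n) := fun x => by
    rw [hf, he]; rfl
  have hfinj : Function.Injective f := by
    refine (injective_iff_map_eq_zero f).2 fun g hg => ?_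
    have hgm : g ∈ Gamma G n := hmem g (hg ▸ zero_mem _)
    have h0 : m • (⟨g, hgm⟩ : Gamma G n) + h ⟨g, hgm⟩ = 0 :=
      Subtype.ext ((hres ⟨g, hgm⟩).symm.trans hg)
    have := @hinj ⟨g, hgm⟩ 0 (by simpa using h0)
    exact congrArg Subtype.val this
  have hfs := hch f hfinj
  rcases hsurj with hns | ⟨-, hnd⟩
  · refine hns fun t => ?_
    obtain ⟨g, hg⟩ := hfs t
    have hgm : g ∈ Gamma G n := hmem g (hg ▸ t.2)
    exact ⟨⟨g, hgm⟩, Subtype.ext ((hres ⟨g, hgm⟩).symm.trans hg)⟩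
  · refine hnd fun q => ?_
    obtain ⟨t, rfl⟩ := QuotientAddGroup.mk_surjective q
    obtain ⟨g, rfl⟩ := hfs t
    refine ⟨g, ?_⟩
    rw [hf, QuotientAddGroup.mk_add, (QuotientAddGroup.eq_zero_iff _).2 (e g).2, add_zero,
      QuotientAddGroup.mk_nsmul]

/-- A bounded `p`-primary part of a co-Hopfian group is a direct summand with `p`-divisible
complement. -/
theorem CoHopfian.exists_retraction {G : Type*} [AddCommGroup G] (hch : CoHopfian G) (p : ℕ)
    (hb : IsBoundedSubgroup (Gamma G p)) :
    ∃ e : G →+ Gamma G p, (∀ x : Gamma G p, e x = x) ∧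
      ∀ g, e g = 0 → ∃ y, e y = 0 ∧ p • y = g := by
  obtain ⟨k, hk0, hk⟩ := hb
  obtain ⟨e, he⟩ := Gamma_exists_extension p hk0 (AddMonoidHom.id (Gamma G p))
    fun x => Subtype.ext (hk x x.2)
  simp only [AddMonoidHom.id_apply] at he
  let f : G →+ G := (Gamma G p).subtype.comp e
    + p • (AddMonoidHom.id G - (Gamma G p).subtype.comp e)
  have hf : ∀ g, f g = e g + p • (g - e g) := fun g => rfl
  have hef : ∀ g, e (f g) = e g := fun g => by simp [hf, he]
  have hfs := hch f <| (injective_iff_map_eq_zero f).2 fun g hg => by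
    have h0 : e g = 0 := by rw [← hef, hg, map_zero]
    have hp : p • g = 0 := by simpa [hf, h0] using hg
    have := he ⟨g, 1, by simpa using hp⟩
    rw [h0] at this
    exact (congrArg Subtype.val this).symm
  refine ⟨e, he, fun g hg => ?_⟩
  obtain ⟨y, rfl⟩ := hfs g
  rw [hef] at hg
  exact ⟨y, hg, by simp [hf, hg]⟩

theorem Finsupp.exists_eq_nsmul_of_forall_dvd {ι : Type*} {k : ℕ} {a : ι →₀ ℤ}
    (h : ∀ b, (k : ℤ) ∣ a b) : ∃ a', a = k • a' :=
  ⟨a.mapRange (· / (k : ℤ)) (by simp), by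
    ext b
    simpa using (Int.mul_ediv_cancel' (h b)).symm⟩

/-- A group containing a pure copy of an infinite direct sum of copies of `ℤ/kℤ`, `k > 1`, is not
co-Hopfian: a shift of the summands extends to the whole group. -/
theorem not_coHopfian_of_reflects_dvd {G ι : Type*} [AddCommGroup G] [Infinite ι] {k : ℕ}
    (hk1 : 1 < k) (j : (ι →₀ ℤ) →+ G) (hj : ∀ x, k • j x = 0)
    (hpure : ∀ d : ℕ, d ∣ k → ∀ (z : G) (x : ι →₀ ℤ), d • z = j x → ∃ x', x = d • x') :
    ¬ CoHopfian G := by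
  intro hch
  obtain ⟨σ, hσ, hσ'⟩ : ∃ σ : ι → ι, Function.Injective σ ∧ ¬ Function.Surjective σ := by
    obtain ⟨b, ⟨η⟩⟩ : ∃ b : ι, Nonempty (ι ≃ ({b}ᶜ : Set ι)) := by
      obtain ⟨b⟩ := (inferInstance : Nonempty ι)
      exact ⟨b, Cardinal.eq.1 (Cardinal.mk_compl_of_infinite _ (by
        simpa using Cardinal.one_lt_aleph0.trans_le (Cardinal.aleph0_le_mk ι))).symm⟩
    exact ⟨fun i => η i, Subtype.val_injective.comp η.injective, fun h => by
      obtain ⟨i, hi⟩ := h b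
      exact (η i).2 hi⟩
  obtain ⟨b₀, hb₀⟩ := not_forall.1 hσ'
  let s : (ι →₀ ℤ) →+ (ι →₀ ℤ) := Finsupp.mapDomain.addMonoidHom σ
  obtain ⟨e, he⟩ := exists_extension_of_reflects_dvd j (by omega) hpure
    (j.rangeRestrict.comp (s - AddMonoidHom.id _)) fun x => Subtype.ext (hj _)
  have hjz : ∀ x, j x = 0 → ∃ x', x = k • x' := fun x hx =>
    hpure k dvd_rfl 0 x (by rw [smul_zero, hx])
  let f : G →+ G := AddMonoidHom.id G + j.range.subtype.comp e
  have hf : ∀ g, f g = g + e g := fun g => rfl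
  have hfj : ∀ x, f (j x) = j (s x) := fun x => by
    rw [hf, he]
    change j x + j (s x - x) = j (s x)
    rw [map_sub]; abel
  have hmem : ∀ g, f g ∈ j.range → ∃ x, j x = g := fun g hg =>
    (AddSubgroup.add_mem_cancel_right _ (e g).2).1 (hf g ▸ hg)
  have hs : ∀ x b, s x (σ b) = x b := fun x b => Finsupp.mapDomain_apply hσ x b
  have hfs := hch f <| (injective_iff_map_eq_zero f).2 fun g hg => by
    obtain ⟨x, rfl⟩ := hmem g (hg ▸ zero_mem _)
    obtain ⟨x', hx'⟩ := hjz (s x) (by rw [← hfj, hg])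
    obtain ⟨x'', rfl⟩ : ∃ x'', x = k • x'' :=
      Finsupp.exists_eq_nsmul_of_forall_dvd fun b => ⟨x' (σ b), by
        rw [← hs, hx']; simp⟩
    rw [map_nsmul, hj]
  obtain ⟨g, hg⟩ := hfs (j (Finsupp.single b₀ 1))
  obtain ⟨x, rfl⟩ := hmem g (hg ▸ ⟨_, rfl⟩)
  obtain ⟨x', hx'⟩ := hjz (Finsupp.single b₀ 1 - s x) (by rw [map_sub, ← hfj, hg, sub_self])
  have h0 : s x b₀ = 0 := Finsupp.mapDomain_of_notMem_range x b₀ hb₀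
  have h1 : (1 : ℤ) = k * x' b₀ := by simpa [h0] using DFunLike.congr_fun hx' b₀
  have : (k : ℤ) = 1 := Int.eq_one_of_dvd_one (by positivity) ⟨_, h1⟩
  omega

/-- An infinite elementary abelian `p`-group has an infinite independent family. -/
theorem exists_infinite_independent_family.{v} {Q : Type v} [AddCommGroup Q] [Infinite Q] {p : ℕ}
    (hp : p.Prime) (hQ : ∀ q : Q, p • q = 0) :
    ∃ (ι : Type v) (_ : Infinite ι) (β : ι → Q),
      ∀ x : ι →₀ ℤ, Finsupp.linearCombination ℤ β x = 0 → ∃ x', x = p • x' := by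
  have : Fact p.Prime := ⟨hp⟩
  have : Module (ZMod p) Q := AddCommGroup.zmodModule hQ
  let β := Module.Basis.ofVectorSpace (ZMod p) Q
  refine ⟨_, ?_, β, fun x hx => ?_⟩
  · refine not_finite_iff_infinite.1 fun hfin => not_finite_iff_infinite.2 ‹Infinite Q› ?_
    have := Module.Finite.of_basis β
    exact Module.finite_of_finite (ZMod p)
  · have h1 : Finsupp.linearCombination (ZMod p) β
        (x.mapRange (Int.cast : ℤ → ZMod p) Int.cast_zero) = 0 := by
      rw [← hx, Finsupp.linearCombination_apply, Finsupp.sum_mapRange_index (by simp),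
        Finsupp.linearCombination_apply]
      exact Finset.sum_congr rfl fun b _ => Int.cast_smul_eq_zsmul _ _ _
    have h2 := linearIndependent_iff.1 β.linearIndependent _ h1
    refine Finsupp.exists_eq_nsmul_of_forall_dvd fun b => ?_
    rw [← ZMod.intCast_zmod_eq_zero_iff_dvd]
    simpa using DFunLike.congr_fun h2 b

/-- In an infinite bounded group of prime power exponent, some Ulm–Kaplansky invariant
is infinite. -/
theorem exists_infinite_basic_family.{v} {T : Type v} [AddCommGroup T] [Infinite T] {p e : ℕ}
    (hp : p.Prime) (hT : ∀ x : T, p ^ e • x = 0) :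
    ∃ (i : ℕ) (ι : Type v) (_ : Infinite ι) (j : (ι →₀ ℤ) →+ T),
      (∀ x, p ^ (i + 1) • j x = 0) ∧
      ∀ x t, p ^ i • j x = p ^ (i + 1) • t → ∃ x', x = p • x' := by
  let φ : ℕ → T →+ T := fun j => nsmulAddMonoidHom (p ^ j)
  have hφ : ∀ j t, φ j t = p ^ j • t := fun _ _ => rfl
  obtain ⟨i, hi, hi'⟩ : ∃ i, ¬ Finite (φ i).range ∧ Finite (φ (i + 1)).range := by
    by_contra! hcon
    have hall : ∀ i, ¬ Finite (φ i).range := fun i => by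
      induction i with
      | zero =>
        intro hfin
        refine not_finite_iff_infinite.2 ‹Infinite T› ?_
        exact Finite.of_injective (fun t => (⟨φ 0 t, t, rfl⟩ : (φ 0).range)) fun a b hab => by
          simpa [hφ] using congrArg Subtype.val hab
      | succ i ih => exact not_finite_iff_infinite.2 (hcon i (not_finite_iff_infinite.1 ih))
    refine hall e ?_
    have : (φ e).range = ⊥ := by
      rw [AddMonoidHom.range_eq_bot_iff]; ext t; exact hT t
    rw [this]; infer_instance
  let A := (φ (i + 1)).ker
  let B := A ⊓ (φ (i + 1)).range.comap (φ i)
  have hA : ∀ t, t ∈ A ↔ p ^ (i + 1) • t = 0 := fun _ => Iff.rfl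
  have hB : ∀ t : A, t ∈ B.addSubgroupOf A ↔ ∃ u, p ^ (i + 1) • u = p ^ i • (t : T) := fun t => by
    rw [AddSubgroup.mem_addSubgroupOf]
    exact ⟨fun h => h.2, fun h => ⟨t.2, h⟩⟩
  have hQinf : Infinite (A ⧸ B.addSubgroupOf A) := by
    refine not_finite_iff_infinite.1 fun hfin => hi ?_
    have hKB : (φ i).ker ≤ B := fun t ht => by
      have ht' : p ^ i • t = 0 := ht
      refine ⟨?_, 0, ?_⟩
      · change p ^ (i + 1) • t = 0
        rw [pow_succ', mul_smul, ht', smul_zero]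
      · rw [map_zero, hφ, ht']
    have h1 : (φ i).ker.relIndex B ≠ 0 := by
      rw [AddSubgroup.relIndex_ker]
      have : Finite (B.map (φ i)) := Finite.Set.subset ((φ (i + 1)).range : Set T) (by
        rintro _ ⟨t, ht, rfl⟩
        exact ht.2)
      exact Nat.card_pos.ne'
    have h2 : B.relIndex A ≠ 0 := Nat.card_pos.ne'
    have h3 : A.index ≠ 0 := by
      rw [AddSubgroup.index_ker]
      exact Nat.card_pos.ne'
    have h4 : (φ i).ker.index ≠ 0 := by
      rw [← AddSubgroup.relIndex_mul_index (hKB.trans inf_le_left),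
        ← AddSubgroup.relIndex_mul_relIndex _ _ _ hKB inf_le_left]
      exact mul_ne_zero (mul_ne_zero h1 h2) h3
    rw [AddSubgroup.index_ker] at h4
    exact Nat.finite_of_card_ne_zero h4
  have hpQ : ∀ q : A ⧸ B.addSubgroupOf A, p • q = 0 := fun q => by
    obtain ⟨t, rfl⟩ := QuotientAddGroup.mk_surjective q
    rw [← QuotientAddGroup.mk_nsmul, QuotientAddGroup.eq_zero_iff, hB]
    refine ⟨0, ?_⟩
    rw [smul_zero, AddSubgroup.coe_nsmul, ← mul_smul, ← pow_succ]
    exact ((hA _).1 t.2).symm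
  obtain ⟨ι, hι, β, hβ⟩ := exists_infinite_independent_family hp hpQ
  choose y hy using fun b => QuotientAddGroup.mk_surjective (β b)
  let Φ : (ι →₀ ℤ) →+ A := (Finsupp.linearCombination ℤ y).toAddMonoidHom
  refine ⟨i, ι, hι, A.subtype.comp Φ, fun x => (hA _).1 (Φ x).2, fun x t hxt => hβ x ?_⟩
  have h0 : QuotientAddGroup.mk' (B.addSubgroupOf A) (Finsupp.linearCombination ℤ y x) = 0 :=
    (QuotientAddGroup.eq_zero_iff _).2 ((hB _).2 ⟨t, hxt.symm⟩)
  rw [← h0, Finsupp.linearCombination_apply, Finsupp.linearCombination_apply, Finsupp.sum,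
    Finsupp.sum, map_sum]
  refine Finset.sum_congr rfl fun b _ => ?_
  rw [map_zsmul, QuotientAddGroup.mk'_apply, hy]

/-- A bounded `p`-primary part of a co-Hopfian group is finite. -/
theorem CoHopfian.finite_Gamma {G : Type*} [AddCommGroup G] (hch : CoHopfian G) {p : ℕ}
    (hp : p.Prime) (hb : IsBoundedSubgroup (Gamma G p)) : Finite (Gamma G p) := by
  by_contra hinf
  rw [not_finite_iff_infinite] at hinf
  obtain ⟨n, hn, hn0⟩ := hb
  obtain ⟨e, b, u, rfl, ⟨c, hbc⟩, hu⟩ := exists_dvd_pow_mul_coprime p hn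
  have hT : ∀ x : Gamma G p, p ^ e • x = 0 := fun x => by
    obtain ⟨l, hl⟩ := x.2
    refine Subtype.ext (eq_zero_of_coprime_nsmul (hu.pow_right l) ?_ ?_)
    · change u • p ^ e • (x : G) = 0
      rw [← mul_smul, hbc, show u * (b * c) = c * (b * u) by ring, mul_smul, hn0 x x.2, smul_zero]
    · change p ^ l • p ^ e • (x : G) = 0
      rw [smul_comm, hl, smul_zero]
  obtain ⟨i, ι, _, j, hj, hind⟩ := exists_infinite_basic_family hp hT
  refine not_coHopfian_of_reflects_dvd (k := p ^ (i + 1))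
    (Nat.one_lt_pow (by omega) hp.one_lt) ((Gamma G p).subtype.comp j)
    (fun x => congrArg Subtype.val (hj x)) ?_ hch
  intro d hd z x hz
  obtain ⟨s, hs, rfl⟩ := (Nat.dvd_prime_pow hp).1 hd
  have hzΓ : z ∈ Gamma G p := by
    obtain ⟨l, hl⟩ := (j x).2
    refine ⟨l + s, ?_⟩
    rw [pow_add, mul_smul, hz]
    exact hl
  lift z to Gamma G p using hzΓ
  replace hz : p ^ s • z = j x := Subtype.ext hz
  clear hd
  induction s generalizing z with
  | zero => exact ⟨x, by simp⟩
  | succ s ih =>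
    obtain ⟨x', rfl⟩ := ih (by omega) (p • z) (by rw [← hz, pow_succ, mul_smul])
    obtain ⟨x'', rfl⟩ := hind x' z (by
      have : p ^ i = p ^ (i - s) * p ^ s := by rw [← pow_add]; congr 1; omega
      rw [this, mul_smul, ← map_nsmul, ← hz, ← mul_smul, ← pow_add]
      congr 2; omega)
    exact ⟨x'', by rw [pow_succ, mul_smul]⟩

theorem Reduced.mk_le_of_finite {G : Type*} [AddCommGroup G] (hred : Reduced G)
    (hch : CoHopfian G) (hb : ∀ p : ℕ, p.Prime → IsBoundedSubgroup (Gamma G p)) :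
    #G ≤ 2 ^ Cardinal.aleph0 := by
  choose e he hdiv using fun p : Nat.Primes => hch.exists_retraction p (hb p p.2)
  have hfin : ∀ p : Nat.Primes, Finite (Gamma G p) := fun p => hch.finite_Gamma p.2 (hb p p.2)
  let D : AddSubgroup G := ⨅ p, (e p).ker
  have hD : ∀ g, g ∈ D ↔ ∀ p, e p g = 0 := fun g => by
    simp [D, AddSubgroup.mem_iInf, AddMonoidHom.mem_ker]
  have hprime : ∀ p : ℕ, p.Prime → ∀ a ∈ D, ∃ b ∈ D, p • b = a := by
    intro p hp a ha
    obtain ⟨y, hy, rfl⟩ := hdiv ⟨p, hp⟩ a ((hD a).1 ha _)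
    refine ⟨y, (hD y).2 fun q => ?_, rfl⟩
    by_cases hqp : q = ⟨p, hp⟩
    · rw [hqp, hy]
    · obtain ⟨l, hl⟩ := (e q y).2
      refine eq_zero_of_coprime_nsmul (a := p) (b := q ^ l) ?_ ?_ (Subtype.ext hl)
      · exact ((Nat.coprime_primes hp q.2).2 fun h => hqp (Subtype.ext h.symm)).pow_right l
      · rw [← map_nsmul]; exact (hD _).1 ha q
  have hDbot : D = ⊥ := hred D fun n => by
    induction n using Nat.recOnMul with
    | zero => simp
    | one => exact fun _ a ha => ⟨a, ha, one_smul _ a⟩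
    | prime p hp => exact fun _ => hprime p hp
    | mul a b iha ihb =>
      intro hab g hg
      obtain ⟨x, hx, rfl⟩ := iha (Nat.pos_of_mul_pos_right hab) g hg
      obtain ⟨y, hy, rfl⟩ := ihb (Nat.pos_of_mul_pos_left hab) x hx
      exact ⟨y, hy, mul_smul _ _ _⟩
  choose i hi using fun p => exists_injective_nat (Gamma G (p : Nat.Primes))
  have hinj : Function.Injective fun (g : G) (p : Nat.Primes) => i p (e p g) := fun a b hab => by
    rw [← sub_eq_zero, ← AddSubgroup.mem_bot, ← hDbot, hD]
    intro p
    rw [map_sub, sub_eq_zero]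
    exact hi p (congrFun hab p)
  have := Cardinal.lift_mk_le_lift_mk_of_injective hinj
  simpa using this

/-- a reduced abelian group of cardinality > 2^ℵ₀ which is co-Hopfian
satisfies Qr_*(G). -/
theorem stmt8 (G : Type*) [AddCommGroup G] (hred : Reduced G)
    (hcard : 2 ^ Cardinal.aleph0 < #G)
    (hch : CoHopfian G) : QrStar G := by
  refine ⟨hch.qr, ?_⟩
  by_contra! hcon
  exact absurd hcard (not_lt.2 (hred.mk_le_of_finite hch hcon))
end
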